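/- arXiv:1211.1001 — 2 statements merged into one kernel-verified Lean document; each statement's English description precedes it below -/
import Mathlib

section
/- (Majority is Stablest, Theorem 1.1) Let 0 ≤ ρ ≤ 1 and ε > 0. Then there exists τ > 0 such that for every n and every function f : {−1,1}ⁿ → [0,1] with E[f] = 1/2 and Inf_i(f) ≤ τ for all i ∈ {1,…,n}, one has Stab_ρ(f) ≤ 1 − (arccos ρ)/π + ε. -/
noncomputable section
namespace DMN

/-- The real sign of a boolean bit: `true ↦ 1`, `false ↦ -1`. -/
def sgn (b : Bool) : ℝ := if b then 1 else -1

/-- The character `χ_S(x) = ∏_{i ∈ S} x_i` on the discrete cube. -/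
def chi {n : ℕ} (S : Finset (Fin n)) (x : Fin n → Bool) : ℝ := ∏ i ∈ S, sgn (x i)

/-- Expectation over the uniform measure on `{-1,1}^n`. -/
def cubeE {n : ℕ} (f : (Fin n → Bool) → ℝ) : ℝ := (∑ x, f x) / 2 ^ n

/-- Fourier coefficient `f̂(S) = E[f · χ_S]`. -/
def fhat {n : ℕ} (f : (Fin n → Bool) → ℝ) (S : Finset (Fin n)) : ℝ :=
  cubeE fun x => f x * chi S x

/-- The influence `Inf_i(f) = Σ_{S ∋ i} f̂(S)²`. -/
def influence {n : ℕ} (f : (Fin n → Bool) → ℝ) (i : Fin n) : ℝ :=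
  ∑ S ∈ Finset.univ.powerset.filter (fun S => i ∈ S), fhat f S ^ 2

/-- The probability weight of the pair `(x, y)` under the uniformly `ρ`-correlated
distribution on `{-1,1}^n × {-1,1}^n`: the coordinate pairs are independent with
uniform marginals and `E[x_i y_i] = ρ`. -/
def corrWeight {n : ℕ} (ρ : ℝ) (x y : Fin n → Bool) : ℝ :=
  ∏ i, (1 + ρ * sgn (x i) * sgn (y i)) / 4

/-- Expectation of `F(x,y)` over a uniformly `ρ`-correlated pair `(x,y)`. -/
def corrE {n : ℕ} (ρ : ℝ) (F : (Fin n → Bool) → (Fin n → Bool) → ℝ) : ℝ :=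
  ∑ x, ∑ y, corrWeight ρ x y * F x y

/-- Noise stability `Stab_ρ(f) = E[f(x)f(y) + (1-f(x))(1-f(y))]` over a
uniformly `ρ`-correlated pair. -/
def noiseStab {n : ℕ} (ρ : ℝ) (f : (Fin n → Bool) → ℝ) : ℝ :=
  corrE ρ fun x y => f x * f y + (1 - f x) * (1 - f y)

section Gaussian

open MeasureTheory Set Filter Topology

/-- The standard Gaussian density. -/
def gauss (t : ℝ) : ℝ := Real.exp (-t ^ 2 / 2) / √(2 * Real.pi)

/-- The standard Gaussian distribution function. -/
def gaussCDF (t : ℝ) : ℝ := ∫ s in Iic t, gauss s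

/-- The density at `(a, b)` of a pair of standard Gaussians with correlation `t`. -/
def binormalDensity (t a b : ℝ) : ℝ :=
  gauss a * gauss ((b - t * a) / √(1 - t ^ 2)) / √(1 - t ^ 2)

/-- The distribution function of a pair of standard Gaussians with correlation `ρ`, written by
means of Plackett's identity `∂F/∂ρ = density`. -/
def binormalCDF (ρ a b : ℝ) : ℝ :=
  gaussCDF a * gaussCDF b + ∫ t in (0 : ℝ)..ρ, binormalDensity t a b

lemma gauss_eq_gaussianPDFReal : gauss = ProbabilityTheory.gaussianPDFReal 0 1 := by
  ext t
  simp [gauss, ProbabilityTheory.gaussianPDFReal, div_eq_inv_mul]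

lemma gauss_pos (t : ℝ) : 0 < gauss t := by unfold gauss; positivity

lemma continuous_gauss : Continuous gauss := by unfold gauss; fun_prop

lemma integrable_gauss : Integrable gauss :=
  gauss_eq_gaussianPDFReal ▸ ProbabilityTheory.integrable_gaussianPDFReal 0 1

lemma integral_gauss : ∫ t, gauss t = 1 :=
  gauss_eq_gaussianPDFReal ▸ ProbabilityTheory.integral_gaussianPDFReal_eq_one 0 one_ne_zero

lemma hasDerivAt_gauss (t : ℝ) : HasDerivAt gauss (-t * gauss t) t := by
  have h : HasDerivAt (fun t : ℝ => -t ^ 2 / 2) (-t) t := by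
    have := ((hasDerivAt_pow 2 t).neg).div_const 2
    refine this.congr_deriv ?_
    simp
    ring
  have := h.exp.div_const √(2 * Real.pi)
  refine this.congr_deriv ?_
  simp only [gauss]; ring

lemma hasDerivAt_gaussCDF (t : ℝ) : HasDerivAt gaussCDF (gauss t) t := by
  have h : gaussCDF = fun s => gaussCDF 0 + ∫ x in (0 : ℝ)..s, gauss x := by
    ext s
    have := intervalIntegral.integral_Iic_sub_Iic (f := gauss) (μ := volume) (a := 0) (b := s)
      integrable_gauss.integrableOn integrable_gauss.integrableOn
    unfold gaussCDF
    linarith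
  rw [h]
  exact (intervalIntegral.integral_hasDerivAt_right (continuous_gauss.intervalIntegrable _ _)
    (continuous_gauss.stronglyMeasurableAtFilter _ _) continuous_gauss.continuousAt).const_add _

lemma continuous_gaussCDF : Continuous gaussCDF :=
  continuous_iff_continuousAt.2 fun t => (hasDerivAt_gaussCDF t).continuousAt

lemma strictMono_gaussCDF : StrictMono gaussCDF :=
  strictMono_of_hasDerivAt_pos hasDerivAt_gaussCDF gauss_pos

lemma tendsto_gaussCDF_atTop : Tendsto gaussCDF atTop (𝓝 1) := by
  rw [← integral_gauss]
  exact (aecover_Iic (μ := (volume : Measure ℝ)) (tendsto_id (α := ℝ)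
    (x := atTop))).integral_tendsto_of_countably_generated integrable_gauss

lemma gaussCDF_add_neg (t : ℝ) : gaussCDF t + gaussCDF (-t) = 1 := by
  have h1 : gaussCDF (-t) = ∫ s in Ioi t, gauss s := by
    have := integral_comp_neg_Ioi t gauss
    unfold gaussCDF
    rw [← this]
    simp [gauss]
  rw [h1, ← integral_gauss, ← compl_Iic]
  exact integral_add_compl measurableSet_Iic integrable_gauss

lemma tendsto_gaussCDF_atBot : Tendsto gaussCDF atBot (𝓝 0) := by
  have h := (tendsto_gaussCDF_atTop.comp tendsto_neg_atBot_atTop).const_sub 1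
  rw [sub_self] at h
  refine h.congr fun t => ?_
  have := gaussCDF_add_neg t
  simp only [Function.comp_apply]
  linarith

lemma gaussCDF_zero : gaussCDF 0 = 1 / 2 := by
  have := gaussCDF_add_neg 0
  rw [neg_zero] at this
  linarith

lemma exists_gaussCDF_eq {x : ℝ} (hx : x ∈ Ioo (0 : ℝ) 1) : ∃ t, gaussCDF t = x :=
  mem_range_of_exists_le_of_exists_ge continuous_gaussCDF
    ((tendsto_gaussCDF_atBot.eventually_le_const hx.1).exists)
    ((tendsto_gaussCDF_atTop.eventually_const_le hx.2).exists)

lemma gaussCDF_mem_Ioo (t : ℝ) : gaussCDF t ∈ Ioo (0 : ℝ) 1 := by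
  constructor
  · have := strictMono_gaussCDF.monotone.le_of_tendsto tendsto_gaussCDF_atBot (t - 1)
    exact this.trans_lt (strictMono_gaussCDF (by linarith))
  · have := strictMono_gaussCDF.monotone.ge_of_tendsto tendsto_gaussCDF_atTop (t + 1)
    exact (strictMono_gaussCDF (by linarith)).trans_le this

/-- The Gaussian quantile function, the inverse of `gaussCDF` on `(0, 1)`. -/
def quantile (x : ℝ) : ℝ := Function.invFun gaussCDF x

lemma gaussCDF_quantile {x : ℝ} (hx : x ∈ Ioo (0 : ℝ) 1) : gaussCDF (quantile x) = x :=
  Function.invFun_eq (exists_gaussCDF_eq hx)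

lemma quantile_gaussCDF (t : ℝ) : quantile (gaussCDF t) = t :=
  Function.leftInverse_invFun strictMono_gaussCDF.injective t

lemma continuousAt_quantile {x : ℝ} (hx : x ∈ Ioo (0 : ℝ) 1) : ContinuousAt quantile x := by
  have hs : Ioo (0 : ℝ) 1 ∈ 𝓝 x := Ioo_mem_nhds hx.1 hx.2
  refine continuousAt_of_monotoneOn_of_image_mem_nhds (s := Ioo (0 : ℝ) 1) ?_ hs ?_
  · intro y hy z hz hyz
    rw [← strictMono_gaussCDF.le_iff_le, gaussCDF_quantile hy, gaussCDF_quantile hz]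
    exact hyz
  · convert univ_mem
    refine eq_univ_of_forall fun t => ⟨gaussCDF t, gaussCDF_mem_Ioo t, quantile_gaussCDF t⟩

lemma hasDerivAt_quantile {x : ℝ} (hx : x ∈ Ioo (0 : ℝ) 1) :
    HasDerivAt quantile (gauss (quantile x))⁻¹ x :=
  (hasDerivAt_gaussCDF (quantile x)).of_local_left_inverse (continuousAt_quantile hx)
    (gauss_pos _).ne'
    (eventually_of_mem (Ioo_mem_nhds hx.1 hx.2) fun _ hy => gaussCDF_quantile hy)

lemma quantile_half : quantile (1 / 2) = 0 := by
  rw [← gaussCDF_zero, quantile_gaussCDF]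

lemma gauss_mul_gauss_comm {t : ℝ} (ht : t ^ 2 < 1) (a b : ℝ) :
    gauss a * gauss ((b - t * a) / √(1 - t ^ 2)) =
      gauss b * gauss ((a - t * b) / √(1 - t ^ 2)) := by
  have h : 0 < 1 - t ^ 2 := by linarith
  have key : ∀ a b : ℝ, gauss a * gauss ((b - t * a) / √(1 - t ^ 2)) =
      Real.exp (-(a ^ 2 - 2 * t * a * b + b ^ 2) / (2 * (1 - t ^ 2))) / √(2 * Real.pi) ^ 2 := by
    intro a b
    unfold gauss
    rw [div_mul_div_comm, ← Real.exp_add, ← sq, div_pow, Real.sq_sqrt h.le]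
    congr 2
    field_simp
    ring
  rw [key a b, key b a]
  ring_nf

lemma binormalDensity_nonneg (t a b : ℝ) : 0 ≤ binormalDensity t a b :=
  div_nonneg (mul_nonneg (gauss_pos _).le (gauss_pos _).le) (Real.sqrt_nonneg _)

lemma binormalDensity_comm {t : ℝ} (ht : t ^ 2 < 1) (a b : ℝ) :
    binormalDensity t a b = binormalDensity t b a := by
  unfold binormalDensity
  rw [gauss_mul_gauss_comm ht]

lemma sq_lt_one_of_mem_uIcc {ρ t : ℝ} (h0 : 0 ≤ ρ) (h1 : ρ < 1) (ht : t ∈ uIcc 0 ρ) :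
    t ^ 2 < 1 := by
  rw [uIcc_of_le h0] at ht
  nlinarith [ht.1, ht.2]

lemma continuousOn_binormalDensity {ρ : ℝ} (h0 : 0 ≤ ρ) (h1 : ρ < 1) (a : ℝ) :
    ContinuousOn (fun p : ℝ × ℝ => binormalDensity p.1 a p.2) (uIcc 0 ρ ×ˢ univ) := by
  have hne : ∀ p ∈ uIcc 0 ρ ×ˢ (univ : Set ℝ), √(1 - p.1 ^ 2) ≠ 0 := fun p hp =>
    (Real.sqrt_pos.2 (by linarith [sq_lt_one_of_mem_uIcc h0 h1 hp.1])).ne'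
  unfold binormalDensity
  refine ContinuousOn.div ?_ (by fun_prop) hne
  refine continuousOn_const.mul (continuous_gauss.comp_continuousOn ?_)
  exact ContinuousOn.div (by fun_prop) (by fun_prop) hne

lemma intervalIntegrable_binormalDensity {ρ : ℝ} (h0 : 0 ≤ ρ) (h1 : ρ < 1) (a b : ℝ) :
    IntervalIntegrable (fun t => binormalDensity t a b) volume 0 ρ :=
  ((continuousOn_binormalDensity h0 h1 a).comp (f := fun t : ℝ => (t, b)) (by fun_prop)
    fun _ ht => ⟨ht, mem_univ _⟩).intervalIntegrable

lemma binormalCDF_comm {ρ : ℝ} (h0 : 0 ≤ ρ) (h1 : ρ < 1) (a b : ℝ) :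
    binormalCDF ρ a b = binormalCDF ρ b a := by
  unfold binormalCDF
  rw [mul_comm, intervalIntegral.integral_congr fun t ht =>
    binormalDensity_comm (sq_lt_one_of_mem_uIcc h0 h1 ht) a b]

lemma mul_le_binormalCDF {ρ : ℝ} (h0 : 0 ≤ ρ) (a b : ℝ) :
    gaussCDF a * gaussCDF b ≤ binormalCDF ρ a b :=
  le_add_of_nonneg_right <|
    intervalIntegral.integral_nonneg h0 fun _ _ => binormalDensity_nonneg _ _ _

lemma hasDerivAt_sqrt_one_sub_sq {t : ℝ} (ht : t ^ 2 < 1) :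
    HasDerivAt (fun t : ℝ => √(1 - t ^ 2)) (-t / √(1 - t ^ 2)) t := by
  have := ((hasDerivAt_pow 2 t).const_sub 1).sqrt (by linarith)
  refine this.congr_deriv ?_
  push_cast
  field_simp

/-- **Sheppard's formula.** -/
lemma binormalCDF_zero_zero {ρ : ℝ} (h0 : 0 ≤ ρ) (h1 : ρ < 1) :
    binormalCDF ρ 0 0 = 1 / 4 + Real.arcsin ρ / (2 * Real.pi) := by
  have hint := intervalIntegrable_binormalDensity h0 h1 0 0
  have hd : ∀ t ∈ uIcc 0 ρ, HasDerivAt (fun t => Real.arcsin t / (2 * Real.pi))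
      (binormalDensity t 0 0) t := by
    intro t ht
    have hsq := sq_lt_one_of_mem_uIcc h0 h1 ht
    have := (Real.hasDerivAt_arcsin (x := t) (by rintro rfl; norm_num at hsq)
      (by rintro rfl; norm_num at hsq)).div_const (2 * Real.pi)
    refine this.congr_deriv ?_
    have h2 : √(2 * Real.pi) * √(2 * Real.pi) = 2 * Real.pi := Real.mul_self_sqrt (by positivity)
    simp only [binormalDensity, gauss, mul_zero, sub_zero, zero_div]
    rw [div_mul_div_comm, h2]
    norm_num
    ring
  rw [binormalCDF, intervalIntegral.integral_eq_sub_of_hasDerivAt hd hint, gaussCDF_zero]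
  simp
  ring

lemma hasDerivAt_binormalDensity_right {t : ℝ} (ht : t ^ 2 < 1) (a b : ℝ) :
    HasDerivAt (fun b => binormalDensity t a b)
      (-((b - t * a) / (1 - t ^ 2)) * binormalDensity t a b) b := by
  have hpos : 0 < 1 - t ^ 2 := by linarith
  have hs : √(1 - t ^ 2) ^ 2 = 1 - t ^ 2 := Real.sq_sqrt hpos.le
  have hs0 : 0 < √(1 - t ^ 2) := Real.sqrt_pos.2 hpos
  have h1 : HasDerivAt (fun b => (b - t * a) / √(1 - t ^ 2)) (1 / √(1 - t ^ 2)) b :=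
    ((hasDerivAt_id b).sub_const _).div_const _
  have := (((hasDerivAt_gauss _).comp b h1).const_mul (gauss a)).div_const √(1 - t ^ 2)
  refine this.congr_deriv ?_
  unfold binormalDensity
  generalize gauss ((b - t * a) / √(1 - t ^ 2)) = z
  field_simp
  rw [hs]

lemma integral_deriv_binormalDensity {ρ : ℝ} (h0 : 0 ≤ ρ) (h1 : ρ < 1) (a b : ℝ)
    (hint : IntervalIntegrable
      (fun t => -((b - t * a) / (1 - t ^ 2)) * binormalDensity t a b) volume 0 ρ) :
    ∫ t in (0 : ℝ)..ρ, -((b - t * a) / (1 - t ^ 2)) * binormalDensity t a b =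
      gauss b * gaussCDF ((a - ρ * b) / √(1 - ρ ^ 2)) - gauss b * gaussCDF a := by
  have hd : ∀ t ∈ uIcc 0 ρ, HasDerivAt
      (fun t => gauss b * gaussCDF ((a - t * b) / √(1 - t ^ 2)))
      (-((b - t * a) / (1 - t ^ 2)) * binormalDensity t a b) t := by
    intro t ht
    have hsq := sq_lt_one_of_mem_uIcc h0 h1 ht
    have hpos : 0 < 1 - t ^ 2 := by linarith
    have hs : √(1 - t ^ 2) ^ 2 = 1 - t ^ 2 := Real.sq_sqrt hpos.le
    have hs0 : 0 < √(1 - t ^ 2) := Real.sqrt_pos.2 hpos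
    have hn : HasDerivAt (fun t => a - t * b) (-b) t := by
      simpa using ((hasDerivAt_id t).mul_const b).const_sub a
    have hc := hn.div (hasDerivAt_sqrt_one_sub_sq hsq) hs0.ne'
    have := ((hasDerivAt_gaussCDF _).comp t hc).const_mul (gauss b)
    refine this.congr_deriv ?_
    rw [binormalDensity_comm hsq]
    unfold binormalDensity
    have e : (-b * √(1 - t ^ 2) - (a - t * b) * (-t / √(1 - t ^ 2))) / √(1 - t ^ 2) ^ 2 =
        -((b - t * a) / (1 - t ^ 2)) / √(1 - t ^ 2) := by
      have : √(1 - t ^ 2) * √(1 - t ^ 2) = 1 - t ^ 2 := by rw [← sq, hs]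
      rw [hs]
      field_simp
      rw [hs]
      ring
    rw [e, Pi.div_apply]
    ring
  rw [intervalIntegral.integral_eq_sub_of_hasDerivAt hd hint]
  simp

lemma hasDerivAt_binormalCDF_right {ρ : ℝ} (h0 : 0 ≤ ρ) (h1 : ρ < 1) (a b : ℝ) :
    HasDerivAt (fun b => binormalCDF ρ a b)
      (gauss b * gaussCDF ((a - ρ * b) / √(1 - ρ ^ 2))) b := by
  set F' : ℝ → ℝ → ℝ := fun b t => -((b - t * a) / (1 - t ^ 2)) * binormalDensity t a b
  have hcont : ContinuousOn (fun p : ℝ × ℝ => F' p.2 p.1) (uIcc 0 ρ ×ˢ univ) := by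
    refine ContinuousOn.mul (ContinuousOn.neg (ContinuousOn.div (by fun_prop) (by fun_prop) ?_))
      (continuousOn_binormalDensity h0 h1 a)
    intro p hp
    linarith [sq_lt_one_of_mem_uIcc h0 h1 hp.1]
  have hslice : ContinuousOn (F' b) (uIcc 0 ρ) :=
    hcont.comp (f := fun t : ℝ => (t, b)) (by fun_prop) fun _ ht => ⟨ht, mem_univ _⟩
  obtain ⟨M, hM⟩ :=
    (isCompact_uIcc.prod (isCompact_Icc (a := b - 1) (b := b + 1))).exists_bound_of_continuousOn
    (hcont.mono (prod_mono subset_rfl (subset_univ _)))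
  have key := intervalIntegral.hasDerivAt_integral_of_dominated_loc_of_deriv_le
    (F := fun b t => binormalDensity t a b) (F' := F') (x₀ := b) (μ := volume) (a := 0) (b := ρ)
    (bound := fun _ => M)
    (Icc_mem_nhds (show b - 1 < b by linarith) (show b < b + 1 by linarith))
    (Eventually.of_forall fun x =>
      (intervalIntegrable_iff.1 (intervalIntegrable_binormalDensity h0 h1 a x)).aestronglyMeasurable)
    (intervalIntegrable_binormalDensity h0 h1 a b)
    (intervalIntegrable_iff.1 hslice.intervalIntegrable).aestronglyMeasurable
    (ae_of_all _ fun t ht x hx => hM (t, x) ⟨uIoc_subset_uIcc ht, hx⟩)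
    intervalIntegrable_const
    (ae_of_all _ fun t ht x _ => hasDerivAt_binormalDensity_right
      (sq_lt_one_of_mem_uIcc h0 h1 (uIoc_subset_uIcc ht)) a x)
  have := ((hasDerivAt_gaussCDF b).const_mul (gaussCDF a)).add key.2
  refine this.congr_deriv ?_
  rw [integral_deriv_binormalDensity h0 h1 a b key.1]
  ring

lemma hasDerivAt_binormalCDF_left {ρ : ℝ} (h0 : 0 ≤ ρ) (h1 : ρ < 1) (a b : ℝ) :
    HasDerivAt (fun a => binormalCDF ρ a b)
      (gauss a * gaussCDF ((b - ρ * a) / √(1 - ρ ^ 2))) a := by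
  simp_rw [fun a => binormalCDF_comm h0 h1 a b]
  exact hasDerivAt_binormalCDF_right h0 h1 b a

/-- Chain rule for the bivariate Gaussian distribution function along a curve. -/
lemma hasDerivAt_binormalCDF_comp {ρ : ℝ} (h0 : 0 ≤ ρ) (h1 : ρ < 1) {α β : ℝ → ℝ} {α' β' t : ℝ}
    (hα : HasDerivAt α α' t) (hβ : HasDerivAt β β' t) :
    HasDerivAt (fun t => binormalCDF ρ (α t) (β t))
      (gauss (α t) * gaussCDF ((β t - ρ * α t) / √(1 - ρ ^ 2)) * α' +
        gauss (β t) * gaussCDF ((α t - ρ * β t) / √(1 - ρ ^ 2)) * β') t := by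
  have hΦ := continuous_gaussCDF
  have hφ := continuous_gauss
  have hl : Continuous (Function.uncurry fun a b : ℝ => ContinuousLinearMap.toSpanSingleton ℝ
      (gauss a * gaussCDF ((b - ρ * a) / √(1 - ρ ^ 2)))) :=
    (ContinuousLinearMap.toSpanSingletonCLE (𝕜 := ℝ) (E := ℝ)).continuous.comp (by fun_prop)
  have hr : Continuous (Function.uncurry fun a b : ℝ => ContinuousLinearMap.toSpanSingleton ℝ
      (gauss b * gaussCDF ((a - ρ * b) / √(1 - ρ ^ 2)))) :=
    (ContinuousLinearMap.toSpanSingletonCLE (𝕜 := ℝ) (E := ℝ)).continuous.comp (by fun_prop)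
  have key := (hasStrictFDerivAt_uncurry_coprod (𝕜 := ℝ) (u := (α t, β t))
    (f := DMN.binormalCDF ρ)
    (Eventually.of_forall fun v => (hasDerivAt_binormalCDF_left h0 h1 v.1 v.2).hasFDerivAt)
    (Eventually.of_forall fun v => (hasDerivAt_binormalCDF_right h0 h1 v.1 v.2).hasFDerivAt)
    (f₁ := fun a b => ContinuousLinearMap.toSpanSingleton ℝ
      (gauss a * gaussCDF ((b - ρ * a) / √(1 - ρ ^ 2))))
    (f₂ := fun a b => ContinuousLinearMap.toSpanSingleton ℝ
      (gauss b * gaussCDF ((a - ρ * b) / √(1 - ρ ^ 2))))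
    hl.continuousAt hr.continuousAt).hasFDerivAt
  have := key.comp_hasDerivAt t (hα.prodMk hβ)
  refine this.congr_deriv ?_
  simp [Function.HasUncurry.uncurry]
  ring


lemma symmetric_second_difference_le {h h' h'' : ℝ → ℝ} {K : ℝ}
    (hh : ∀ t ∈ Icc (-1 : ℝ) 1, HasDerivAt h (h' t) t)
    (hh' : ∀ t ∈ Icc (-1 : ℝ) 1, HasDerivAt h' (h'' t) t)
    (hK : ∀ t ∈ Icc (-1 : ℝ) 1, h'' t ≤ K) :
    h 1 + h (-1) - 2 * h 0 ≤ K := by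
  have hd : ∀ t ∈ Icc (-1 : ℝ) 1, HasDerivAt (fun t => h' t - K * t) (h'' t - K) t := fun t ht =>
    ((hh' t ht).sub ((hasDerivAt_id t).const_mul K)).congr_deriv (by ring)
  have hanti : AntitoneOn (fun t => h' t - K * t) (Icc (-1) 1) := by
    refine antitoneOn_of_hasDerivWithinAt_nonpos (f' := fun t => h'' t - K) (convex_Icc _ _)
      (fun t ht => (hd t ht).continuousAt.continuousWithinAt)
      (fun t ht => (hd t (interior_subset ht)).hasDerivWithinAt) fun t ht => ?_
    linarith [hK t (interior_subset ht)]
  have hmem : ∀ t ∈ Icc (0 : ℝ) 1, t ∈ Icc (-1 : ℝ) 1 ∧ -t ∈ Icc (-1 : ℝ) 1 := fun t ht =>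
    ⟨⟨by linarith [ht.1], ht.2⟩, ⟨by linarith [ht.2], by linarith [ht.1]⟩⟩
  have hk : ∀ t ∈ Icc (0 : ℝ) 1, HasDerivAt (fun t => h t + h (-t) - K * t ^ 2)
      (h' t - h' (-t) - 2 * K * t) t := fun t ht => by
    have h1 := (hh (-t) (hmem t ht).2).comp t (hasDerivAt_neg t)
    refine (((hh t (hmem t ht).1).add h1).sub ((hasDerivAt_pow 2 t).const_mul K)).congr_deriv ?_
    push_cast
    ring
  have hanti' : AntitoneOn (fun t => h t + h (-t) - K * t ^ 2) (Icc 0 1) := by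
    refine antitoneOn_of_hasDerivWithinAt_nonpos (f' := fun t => h' t - h' (-t) - 2 * K * t)
      (convex_Icc _ _) (fun t ht => (hk t ht).continuousAt.continuousWithinAt)
      (fun t ht => (hk t (interior_subset ht)).hasDerivWithinAt) fun t ht => ?_
    have ht' := interior_subset ht
    have := hanti (hmem t ht').2 (hmem t ht').1 (by linarith [ht'.1])
    simp only at this
    linarith
  have := hanti' (left_mem_Icc.2 zero_le_one) (right_mem_Icc.2 zero_le_one) zero_le_one
  norm_num at this
  linarith

lemma exists_modulus_of_continuousOn {F : ℝ × ℝ → ℝ} {s : Set (ℝ × ℝ)} (hs : IsCompact s)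
    (hF : ContinuousOn F s) {a : ℝ} (ha : 0 < a) :
    ∃ c, 0 ≤ c ∧ ∀ p ∈ s, ∀ q ∈ s,
      |F p - F q| ≤ a + c * ((p.1 - q.1) ^ 2 + (p.2 - q.2) ^ 2) := by
  obtain ⟨η, hη, hu⟩ := Metric.uniformContinuousOn_iff.1
    (hs.uniformContinuousOn_of_continuous hF) a ha
  obtain ⟨M, hM⟩ := hs.exists_bound_of_continuousOn hF
  refine ⟨2 * |M| / η ^ 2, by positivity, fun p hp q hq => ?_⟩
  rcases lt_or_ge (dist p q) η with h | h
  · have := hu p hp q hq h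
    rw [Real.dist_eq] at this
    have h2 : 0 ≤ 2 * |M| / η ^ 2 * ((p.1 - q.1) ^ 2 + (p.2 - q.2) ^ 2) := by positivity
    linarith
  · have h1 : |F p - F q| ≤ 2 * |M| := by
      have := abs_sub (F p) (F q)
      have h3 := hM p hp
      have h4 := hM q hq
      rw [Real.norm_eq_abs] at h3 h4
      linarith [le_abs_self M]
    have h2 : η ^ 2 ≤ (p.1 - q.1) ^ 2 + (p.2 - q.2) ^ 2 := by
      rw [Prod.dist_eq, Real.dist_eq, Real.dist_eq] at h
      rcases le_max_iff.1 h with h | h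
      · have := pow_le_pow_left₀ hη.le h 2
        rw [sq_abs] at this
        nlinarith [sq_nonneg (p.2 - q.2)]
      · have := pow_le_pow_left₀ hη.le h 2
        rw [sq_abs] at this
        nlinarith [sq_nonneg (p.1 - q.1)]
    have h3 : 2 * |M| ≤ 2 * |M| / η ^ 2 * ((p.1 - q.1) ^ 2 + (p.2 - q.2) ^ 2) := by
      rw [div_mul_eq_mul_div, le_div_iff₀ (by positivity)]
      gcongr
    linarith

/-- The one-bit inequality: the expectation of `J (x ± u) (y ± v)` over `ρ`-correlated signs
is at most `J x y + w u + w v`. -/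
def FourPoint (ρ : ℝ) (J : ℝ → ℝ → ℝ) (w : ℝ → ℝ) : Prop :=
  ∀ x y u v : ℝ, x + u ∈ Icc (0 : ℝ) 1 → x - u ∈ Icc (0 : ℝ) 1 →
    y + v ∈ Icc (0 : ℝ) 1 → y - v ∈ Icc (0 : ℝ) 1 →
    (1 + ρ) / 4 * (J (x + u) (y + v) + J (x - u) (y - v)) +
      (1 - ρ) / 4 * (J (x + u) (y - v) + J (x - u) (y + v)) ≤ J x y + (w u + w v)

lemma exists_fourPoint {ρ : ℝ} (hρ : ρ ∈ Icc (-1 : ℝ) 1) {J P Q A B D : ℝ → ℝ → ℝ}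
    (hJ : ∀ x ∈ Icc (0 : ℝ) 1, ∀ y ∈ Icc (0 : ℝ) 1, ∀ u v,
      HasDerivAt (fun t => J (x + t * u) (y + t * v)) (u * P x y + v * Q x y) 0)
    (hP : ∀ x ∈ Icc (0 : ℝ) 1, ∀ y ∈ Icc (0 : ℝ) 1, ∀ u v,
      HasDerivAt (fun t => P (x + t * u) (y + t * v)) (u * A x y + v * B x y) 0)
    (hQ : ∀ x ∈ Icc (0 : ℝ) 1, ∀ y ∈ Icc (0 : ℝ) 1, ∀ u v,
      HasDerivAt (fun t => Q (x + t * u) (y + t * v)) (u * B x y + v * D x y) 0)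
    (hA : ContinuousOn (Function.uncurry A) (Icc 0 1 ×ˢ Icc 0 1))
    (hB : ContinuousOn (Function.uncurry B) (Icc 0 1 ×ˢ Icc 0 1))
    (hD : ContinuousOn (Function.uncurry D) (Icc 0 1 ×ˢ Icc 0 1))
    (hneg : ∀ x ∈ Icc (0 : ℝ) 1, ∀ y ∈ Icc (0 : ℝ) 1, ∀ u v,
      u ^ 2 * A x y + 2 * ρ * (u * v * B x y) + v ^ 2 * D x y ≤ 0) {a : ℝ} (ha : 0 < a) :
    ∃ c, 0 ≤ c ∧ FourPoint ρ J fun u => a * u ^ 2 + c * u ^ 4 := by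
  have hK : IsCompact (Icc (0 : ℝ) 1 ×ˢ Icc (0 : ℝ) 1) := isCompact_Icc.prod isCompact_Icc
  obtain ⟨c₁, hc₁, h₁⟩ := exists_modulus_of_continuousOn hK hA ha
  obtain ⟨c₂, hc₂, h₂⟩ := exists_modulus_of_continuousOn hK hB ha
  obtain ⟨c₃, hc₃, h₃⟩ := exists_modulus_of_continuousOn hK hD ha
  set c := c₁ + c₂ + c₃ with hc
  have translate : ∀ {F : ℝ → ℝ → ℝ} {F₁ F₂ : ℝ → ℝ → ℝ},
      (∀ x ∈ Icc (0 : ℝ) 1, ∀ y ∈ Icc (0 : ℝ) 1, ∀ u v,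
        HasDerivAt (fun t => F (x + t * u) (y + t * v)) (u * F₁ x y + v * F₂ x y) 0) →
      ∀ x y u v t, x + t * u ∈ Icc (0 : ℝ) 1 → y + t * v ∈ Icc (0 : ℝ) 1 →
        HasDerivAt (fun t => F (x + t * u) (y + t * v))
          (u * F₁ (x + t * u) (y + t * v) + v * F₂ (x + t * u) (y + t * v)) t := by
    intro F F₁ F₂ hF x y u v t hx hy
    have h := hF _ hx _ hy u v
    rw [← sub_self t] at h
    refine (h.comp_sub_const t t).congr_of_eventuallyEq (Eventually.of_forall fun s => ?_)
    simp only
    congr 1 <;> ring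
  have second : ∀ x y u v : ℝ, x + u ∈ Icc (0 : ℝ) 1 → x - u ∈ Icc (0 : ℝ) 1 →
      y + v ∈ Icc (0 : ℝ) 1 → y - v ∈ Icc (0 : ℝ) 1 →
      J (x + u) (y + v) + J (x - u) (y - v) - 2 * J x y ≤
        u ^ 2 * A x y + 2 * (u * v * B x y) + v ^ 2 * D x y +
          (2 * a * (u ^ 2 + v ^ 2) + 4 * c * (u ^ 4 + v ^ 4)) := by
    intro x y u v hxu hxu' hyv hyv'
    have conv : ∀ x u t : ℝ, x + u ∈ Icc (0 : ℝ) 1 → x - u ∈ Icc (0 : ℝ) 1 →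
        t ∈ Icc (-1 : ℝ) 1 → x + t * u ∈ Icc (0 : ℝ) 1 := by
      intro x u t h h' ht
      constructor
      · nlinarith [mul_nonneg (sub_nonneg.2 ht.1) h.1, mul_nonneg (sub_nonneg.2 ht.2) h'.1]
      · nlinarith [mul_nonneg (sub_nonneg.2 ht.1) (sub_nonneg.2 h.2),
          mul_nonneg (sub_nonneg.2 ht.2) (sub_nonneg.2 h'.2)]
    have hx0 : x ∈ Icc (0 : ℝ) 1 := by simpa using conv x u 0 hxu hxu' (by norm_num)
    have hy0 : y ∈ Icc (0 : ℝ) 1 := by simpa using conv y v 0 hyv hyv' (by norm_num)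
    have key := symmetric_second_difference_le (h := fun t => J (x + t * u) (y + t * v))
      (h' := fun t => u * P (x + t * u) (y + t * v) + v * Q (x + t * u) (y + t * v))
      (h'' := fun t => u ^ 2 * A (x + t * u) (y + t * v) +
        2 * (u * v * B (x + t * u) (y + t * v)) + v ^ 2 * D (x + t * u) (y + t * v))
      (K := u ^ 2 * A x y + 2 * (u * v * B x y) + v ^ 2 * D x y +
          (2 * a * (u ^ 2 + v ^ 2) + 4 * c * (u ^ 4 + v ^ 4)))
      (fun t ht => translate hJ x y u v t (conv x u t hxu hxu' ht) (conv y v t hyv hyv' ht))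
      (fun t ht => (((translate hP x y u v t (conv x u t hxu hxu' ht)
        (conv y v t hyv hyv' ht)).const_mul u).add
        ((translate hQ x y u v t (conv x u t hxu hxu' ht)
        (conv y v t hyv hyv' ht)).const_mul v)).congr_deriv (by ring))
      (fun t ht => by
        have hp : (x + t * u, y + t * v) ∈ Icc (0 : ℝ) 1 ×ˢ Icc (0 : ℝ) 1 :=
          ⟨conv x u t hxu hxu' ht, conv y v t hyv hyv' ht⟩
        have hq : (x, y) ∈ Icc (0 : ℝ) 1 ×ˢ Icc (0 : ℝ) 1 := ⟨hx0, hy0⟩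
        have bound : ∀ c' G, c' ≤ c → G ≤ a + c' * ((x + t * u - x) ^ 2 + (y + t * v - y) ^ 2) →
            G ≤ a + c * (u ^ 2 + v ^ 2) := by
          intro c' G hc' hG
          have ht2 : t ^ 2 ≤ 1 := by nlinarith [ht.1, ht.2]
          have e : (x + t * u - x) ^ 2 + (y + t * v - y) ^ 2 = t ^ 2 * (u ^ 2 + v ^ 2) := by ring
          rw [e] at hG
          have h0 : 0 ≤ u ^ 2 + v ^ 2 := by positivity
          have : c' * (t ^ 2 * (u ^ 2 + v ^ 2)) ≤ c * (u ^ 2 + v ^ 2) := by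
            have h5 : t ^ 2 * (u ^ 2 + v ^ 2) ≤ u ^ 2 + v ^ 2 := by nlinarith
            have h6 : 0 ≤ t ^ 2 * (u ^ 2 + v ^ 2) := by positivity
            have h7 : 0 ≤ c := by positivity
            exact (mul_le_mul_of_nonneg_right hc' h6).trans (mul_le_mul_of_nonneg_left h5 h7)
          linarith
        have b₁ := bound c₁ _ (by linarith) (h₁ _ hp _ hq)
        have b₂ := bound c₂ _ (by linarith) (h₂ _ hp _ hq)
        have b₃ := bound c₃ _ (by linarith) (h₃ _ hp _ hq)
        simp only [Function.uncurry] at b₁ b₂ b₃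
        set E := a + c * (u ^ 2 + v ^ 2) with hE
        have t₁ : u ^ 2 * (A (x + t * u) (y + t * v) - A x y) ≤ u ^ 2 * E :=
          mul_le_mul_of_nonneg_left ((le_abs_self _).trans b₁) (sq_nonneg u)
        have t₃ : v ^ 2 * (D (x + t * u) (y + t * v) - D x y) ≤ v ^ 2 * E :=
          mul_le_mul_of_nonneg_left ((le_abs_self _).trans b₃) (sq_nonneg v)
        have t₂ : 2 * (u * v) * (B (x + t * u) (y + t * v) - B x y) ≤ (u ^ 2 + v ^ 2) * E := by
          refine (le_abs_self _).trans ?_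
          rw [abs_mul]
          refine mul_le_mul ?_ b₂ (abs_nonneg _) (by positivity)
          rw [abs_le]
          constructor <;> nlinarith [sq_nonneg (u + v), sq_nonneg (u - v)]
        have t₄ : c * (u ^ 2 + v ^ 2) ^ 2 ≤ c * (2 * (u ^ 4 + v ^ 4)) := by
          have : 0 ≤ c := by positivity
          refine mul_le_mul_of_nonneg_left ?_ this
          nlinarith [sq_nonneg (u ^ 2 - v ^ 2)]
        nlinarith)
    simpa [sub_eq_add_neg] using key
  refine ⟨2 * c, by positivity, fun x y u v hxu hxu' hyv hyv' => ?_⟩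
  have s₁ := second x y u v hxu hxu' hyv hyv'
  have s₂ := second x y u (-v) hxu hxu'
    (by simpa [← sub_eq_add_neg] using hyv') (by simpa using hyv)
  have hx0 : x ∈ Icc (0 : ℝ) 1 := ⟨by linarith [hxu.1, hxu'.1], by linarith [hxu.2, hxu'.2]⟩
  have hy0 : y ∈ Icc (0 : ℝ) 1 := ⟨by linarith [hyv.1, hyv'.1], by linarith [hyv.2, hyv'.2]⟩
  have hn := hneg x hx0 y hy0 u v
  rw [sub_neg_eq_add, ← sub_eq_add_neg] at s₂
  have e₁ := mul_le_mul_of_nonneg_left s₁ (show 0 ≤ (1 + ρ) / 4 by linarith [hρ.1])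
  have e₂ := mul_le_mul_of_nonneg_left s₂ (show 0 ≤ (1 - ρ) / 4 by linarith [hρ.2])
  simp only [even_two, Even.neg_pow, show Even 4 from ⟨2, rfl⟩] at e₂
  linarith


/-- An affine image of the quantile function, smooth on a neighbourhood of `[0, 1]`. -/
def smoothQuantile (δ x : ℝ) : ℝ := quantile (δ + (1 - 2 * δ) * x)

lemma affine_mem_Ioo {δ x : ℝ} (hδ : 0 < δ) (hδ' : δ < 1 / 2) (hx : x ∈ Icc (0 : ℝ) 1) :
    δ + (1 - 2 * δ) * x ∈ Ioo (0 : ℝ) 1 := by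
  constructor <;> nlinarith [hx.1, hx.2]

lemma hasDerivAt_smoothQuantile {δ x : ℝ} (hδ : 0 < δ) (hδ' : δ < 1 / 2)
    (hx : x ∈ Icc (0 : ℝ) 1) :
    HasDerivAt (smoothQuantile δ) ((1 - 2 * δ) / gauss (smoothQuantile δ x)) x := by
  have h : HasDerivAt (fun x => δ + (1 - 2 * δ) * x) (1 - 2 * δ) x := by
    simpa using ((hasDerivAt_id x).const_mul (1 - 2 * δ)).const_add δ
  refine ((hasDerivAt_quantile (affine_mem_Ioo hδ hδ' hx)).comp x h).congr_deriv ?_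
  rw [smoothQuantile]
  ring

/-- The function `J_ρ` of De, Mossel and Neeman, precomposed with an affine contraction of the
unit square into its interior. -/
def gaussJ (ρ δ x y : ℝ) : ℝ := binormalCDF ρ (smoothQuantile δ x) (smoothQuantile δ y)

lemma gaussJ_half {ρ : ℝ} (h0 : 0 ≤ ρ) (h1 : ρ < 1) (δ : ℝ) :
    gaussJ ρ δ (1 / 2) (1 / 2) = 1 / 4 + Real.arcsin ρ / (2 * Real.pi) := by
  have : smoothQuantile δ (1 / 2) = 0 := by
    rw [smoothQuantile, ← quantile_half]
    congr 1
    ring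
  rw [gaussJ, this, binormalCDF_zero_zero h0 h1]

lemma mul_sub_le_gaussJ {ρ δ x y : ℝ} (h0 : 0 ≤ ρ) (hδ : 0 < δ) (hδ' : δ < 1 / 2)
    (hx : x ∈ Icc (0 : ℝ) 1) (hy : y ∈ Icc (0 : ℝ) 1) :
    x * y - 2 * δ ≤ gaussJ ρ δ x y := by
  have hX := affine_mem_Ioo hδ hδ' hx
  have hY := affine_mem_Ioo hδ hδ' hy
  have h := mul_le_binormalCDF h0 (smoothQuantile δ x) (smoothQuantile δ y)
  rw [smoothQuantile, smoothQuantile, gaussCDF_quantile hX, gaussCDF_quantile hY] at h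
  refine le_trans ?_ h
  have e₁ : -δ ≤ δ * (1 - 2 * x) * (δ + (1 - 2 * δ) * y) := by
    have : -1 ≤ (1 - 2 * x) * (δ + (1 - 2 * δ) * y) := by
      nlinarith [hX.1, hX.2, hY.1, hY.2, hx.1, hx.2]
    nlinarith
  have e₂ : -δ ≤ x * (δ * (1 - 2 * y)) := by
    have : -1 ≤ x * (1 - 2 * y) := by nlinarith [hx.1, hx.2, hy.1, hy.2]
    nlinarith
  nlinarith

lemma exists_fourPoint_gaussJ {ρ δ : ℝ} (h0 : 0 ≤ ρ) (h1 : ρ < 1) (hδ : 0 < δ) (hδ' : δ < 1 / 2)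
    {a : ℝ} (ha : 0 < a) :
    ∃ c, 0 ≤ c ∧ FourPoint ρ (gaussJ ρ δ) fun u => a * u ^ 2 + c * u ^ 4 := by
  set q := smoothQuantile δ with hq
  set m : ℝ → ℝ := fun x => (1 - 2 * δ) / gauss (q x) with hm
  set r := √(1 - ρ ^ 2) with hr
  have hsq : ρ ^ 2 < 1 := by nlinarith
  have hr0 : 0 < r := Real.sqrt_pos.2 (by linarith)
  set E : ℝ → ℝ → ℝ := fun x y => gauss (q x) * gauss ((q y - ρ * q x) / r) with hE
  have hE_comm : ∀ x y, E x y = E y x := fun x y => gauss_mul_gauss_comm hsq _ _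
  have hE_nonneg : ∀ x y, 0 ≤ E x y := fun x y => (mul_pos (gauss_pos _) (gauss_pos _)).le
  have hqd : ∀ x ∈ Icc (0 : ℝ) 1, HasDerivAt q (m x) x := fun x hx =>
    hasDerivAt_smoothQuantile hδ hδ' hx
  have hline : ∀ x ∈ Icc (0 : ℝ) 1, ∀ u,
      HasDerivAt (fun t => q (x + t * u)) (u * m x) 0 := by
    intro x hx u
    have h : HasDerivAt (fun t : ℝ => x + t * u) u 0 := by
      simpa using ((hasDerivAt_id (0 : ℝ)).mul_const u).const_add x
    have h' : HasDerivAt q (m x) (x + 0 * u) := by simpa using hqd x hx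
    exact (h'.comp 0 h).congr_deriv (mul_comm _ _)
  have hgm : ∀ x, gauss (q x) * m x = 1 - 2 * δ := fun x => by
    rw [hm]
    field_simp [(gauss_pos (q x)).ne']
  have hP : ∀ x ∈ Icc (0 : ℝ) 1, ∀ y ∈ Icc (0 : ℝ) 1, ∀ u v,
      HasDerivAt (fun t => (1 - 2 * δ) *
          gaussCDF ((q (y + t * v) - ρ * q (x + t * u)) / r))
        (u * (-(ρ / r) * E x y * m x ^ 2) + v * (1 / r * E x y * m x * m y)) 0 := by
    intro x hx y hy u v
    have h := (((hline y hy v).sub ((hline x hx u).const_mul ρ)).div_const r)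
    have := ((hasDerivAt_gaussCDF _).comp 0 h).const_mul (1 - 2 * δ)
    refine this.congr_deriv ?_
    simp only [zero_mul, add_zero, Pi.sub_apply]
    rw [← hgm x, hE]
    field_simp
    ring
  have hqc : ContinuousOn q (Icc 0 1) := fun x hx => (hqd x hx).continuousAt.continuousWithinAt
  have hq1 : ContinuousOn (fun p : ℝ × ℝ => q p.1) (Icc 0 1 ×ˢ Icc 0 1) :=
    hqc.comp continuousOn_fst fun _ hp => hp.1
  have hq2 : ContinuousOn (fun p : ℝ × ℝ => q p.2) (Icc 0 1 ×ˢ Icc 0 1) :=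
    hqc.comp continuousOn_snd fun _ hp => hp.2
  have hm1 : ContinuousOn (fun p : ℝ × ℝ => m p.1) (Icc 0 1 ×ˢ Icc 0 1) :=
    continuousOn_const.div (continuous_gauss.comp_continuousOn hq1) fun _ _ => (gauss_pos _).ne'
  have hm2 : ContinuousOn (fun p : ℝ × ℝ => m p.2) (Icc 0 1 ×ˢ Icc 0 1) :=
    continuousOn_const.div (continuous_gauss.comp_continuousOn hq2) fun _ _ => (gauss_pos _).ne'
  have hEc : ContinuousOn (fun p : ℝ × ℝ => E p.1 p.2) (Icc 0 1 ×ˢ Icc 0 1) :=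
    (continuous_gauss.comp_continuousOn hq1).mul
      (continuous_gauss.comp_continuousOn ((hq2.sub (hq1.const_mul ρ)).div_const r))
  refine exists_fourPoint (P := fun x y => (1 - 2 * δ) * gaussCDF ((q y - ρ * q x) / r))
    (Q := fun x y => (1 - 2 * δ) * gaussCDF ((q x - ρ * q y) / r))
    (A := fun x y => -(ρ / r) * E x y * m x ^ 2) (B := fun x y => 1 / r * E x y * m x * m y)
    (D := fun x y => -(ρ / r) * E x y * m y ^ 2) ⟨by linarith, h1.le⟩ ?_ hP ?_ ?_ ?_ ?_ ?_ ha
  · intro x hx y hy u v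
    refine (hasDerivAt_binormalCDF_comp h0 h1 (hline x hx u) (hline y hy v)).congr_deriv ?_
    simp only [zero_mul, add_zero]
    linear_combination u * gaussCDF ((q y - ρ * q x) / r) * hgm x +
      v * gaussCDF ((q x - ρ * q y) / r) * hgm y
  · intro x hx y hy u v
    refine (hP y hy x hx v u).congr_deriv ?_
    rw [hE_comm y x]
    ring
  · exact (continuousOn_const.mul hEc).mul (hm1.pow 2)
  · exact ((continuousOn_const.mul hEc).mul hm1).mul hm2
  · exact (continuousOn_const.mul hEc).mul (hm2.pow 2)
  · intro x _ y _ u v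
    have e : u ^ 2 * (-(ρ / r) * E x y * m x ^ 2) + 2 * ρ * (u * v * (1 / r * E x y * m x * m y)) +
        v ^ 2 * (-(ρ / r) * E x y * m y ^ 2) = -(ρ / r * E x y * (u * m x - v * m y) ^ 2) := by
      ring
    rw [e, neg_nonpos]
    have := hE_nonneg x y
    positivity

end Gaussian

open Finset in
lemma sum_prod_bool {n : ℕ} (F : Fin n → Bool → ℝ) :
    ∑ x : Fin n → Bool, ∏ i, F i (x i) = ∏ i, (F i true + F i false) := by
  have := Finset.prod_univ_sum (fun _ : Fin n => (univ : Finset Bool)) F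
  simp only [Fintype.piFinset_univ, Fintype.sum_bool] at this
  exact this.symm

lemma sgn_sq (b : Bool) : sgn b ^ 2 = 1 := by cases b <;> simp [sgn]

lemma sgn_mul_sgn_mem (a b : Bool) : sgn a * sgn b = 1 ∨ sgn a * sgn b = -1 := by
  cases a <;> cases b <;> simp [sgn]

section Expectation

variable {n : ℕ}

lemma cubeE_add (f g : (Fin n → Bool) → ℝ) :
    cubeE (fun x => f x + g x) = cubeE f + cubeE g := by
  simp [cubeE, Finset.sum_add_distrib, add_div]

lemma cubeE_const_mul (a : ℝ) (f : (Fin n → Bool) → ℝ) :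
    cubeE (fun x => a * f x) = a * cubeE f := by
  simp [cubeE, ← Finset.mul_sum, mul_div_assoc]

lemma cubeE_sum {ι : Type*} (s : Finset ι) (f : ι → (Fin n → Bool) → ℝ) :
    cubeE (fun x => ∑ i ∈ s, f i x) = ∑ i ∈ s, cubeE (f i) := by
  simp only [cubeE]
  rw [Finset.sum_comm, Finset.sum_div]

lemma cubeE_const (a : ℝ) : cubeE (fun _ : Fin n → Bool => a) = a := by
  simp [cubeE]

lemma cubeE_mono {f g : (Fin n → Bool) → ℝ} (h : ∀ x, f x ≤ g x) : cubeE f ≤ cubeE g := by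
  unfold cubeE
  gcongr
  exact h _

lemma cubeE_nonneg {f : (Fin n → Bool) → ℝ} (h : ∀ x, 0 ≤ f x) : 0 ≤ cubeE f := by
  simpa [cubeE_const] using cubeE_mono (f := fun _ => 0) h

lemma cubeE_mem_Icc {f : (Fin n → Bool) → ℝ} (h : ∀ x, f x ∈ Set.Icc (0 : ℝ) 1) :
    cubeE f ∈ Set.Icc (0 : ℝ) 1 :=
  ⟨cubeE_nonneg fun x => (h x).1, by
    simpa [cubeE_const] using cubeE_mono (g := fun _ => 1) fun x => (h x).2⟩

lemma sq_cubeE_mul_le (f g : (Fin n → Bool) → ℝ) :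
    cubeE (fun x => f x * g x) ^ 2 ≤ cubeE (fun x => f x ^ 2) * cubeE (fun x => g x ^ 2) := by
  unfold cubeE
  rw [div_pow, div_mul_div_comm, ← sq]
  gcongr
  exact Finset.sum_mul_sq_le_sq_mul_sq _ _ _

lemma sq_cubeE_le (f : (Fin n → Bool) → ℝ) : cubeE f ^ 2 ≤ cubeE (fun x => f x ^ 2) := by
  simpa [cubeE_const] using sq_cubeE_mul_le f fun _ => 1

lemma pow_four_cubeE_le (f : (Fin n → Bool) → ℝ) : cubeE f ^ 4 ≤ cubeE (fun x => f x ^ 4) := by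
  have h₁ := sq_cubeE_le f
  have h₂ := sq_cubeE_le fun x => f x ^ 2
  simp only [← pow_mul] at h₂
  calc cubeE f ^ 4 = (cubeE f ^ 2) ^ 2 := by ring
    _ ≤ cubeE (fun x => f x ^ 2) ^ 2 := by gcongr
    _ ≤ _ := h₂

/-- The restriction of a function on the cube to the facet on which the first bit is `b`. -/
def facet (b : Bool) (f : (Fin (n + 1) → Bool) → ℝ) (x : Fin n → Bool) : ℝ :=
  f (Fin.cons b x)

lemma sum_cube_succ {M : Type*} [AddCommMonoid M] (f : (Fin (n + 1) → Bool) → M) :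
    ∑ x, f x =
      ∑ x : Fin n → Bool, f (Fin.cons true x) + ∑ x : Fin n → Bool, f (Fin.cons false x) := by
  rw [← (Fin.consEquiv fun _ : Fin (n + 1) => Bool).sum_comp, Fintype.sum_prod_type,
    Fintype.sum_bool]
  rfl

lemma cubeE_succ (f : (Fin (n + 1) → Bool) → ℝ) :
    cubeE f = (cubeE (facet true f) + cubeE (facet false f)) / 2 := by
  simp only [cubeE, facet]
  rw [sum_cube_succ, pow_succ]
  field_simp

lemma corrWeight_cons (ρ : ℝ) (a b : Bool) (x y : Fin n → Bool) :
    corrWeight ρ (Fin.cons a x) (Fin.cons b y) =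
      (1 + ρ * sgn a * sgn b) / 4 * corrWeight ρ x y := by
  simp only [corrWeight, Fin.prod_univ_succ, Fin.cons_zero, Fin.cons_succ]

lemma corrE_succ (ρ : ℝ) (F : (Fin (n + 1) → Bool) → (Fin (n + 1) → Bool) → ℝ) :
    corrE ρ F =
      (1 + ρ) / 4 * (corrE ρ (fun x y : Fin n → Bool => F (Fin.cons true x) (Fin.cons true y)) +
        corrE ρ (fun x y : Fin n → Bool => F (Fin.cons false x) (Fin.cons false y))) +
      (1 - ρ) / 4 * (corrE ρ (fun x y : Fin n → Bool => F (Fin.cons true x) (Fin.cons false y)) +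
        corrE ρ (fun x y : Fin n → Bool => F (Fin.cons false x) (Fin.cons true y))) := by
  simp only [corrE, sum_cube_succ, corrWeight_cons, Finset.sum_add_distrib, mul_assoc,
    ← Finset.mul_sum]
  simp only [sgn]
  norm_num
  ring

/-- The discrete derivative in direction `i`. -/
def discreteDeriv (i : Fin n) (f : (Fin n → Bool) → ℝ) (x : Fin n → Bool) : ℝ :=
  (f (Function.update x i true) - f (Function.update x i false)) / 2

lemma facet_discreteDeriv_zero (b : Bool) (f : (Fin (n + 1) → Bool) → ℝ) (x : Fin n → Bool) :
    facet b (discreteDeriv 0 f) x = (facet true f x - facet false f x) / 2 := by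
  simp [facet, discreteDeriv]

lemma facet_discreteDeriv_succ (b : Bool) (i : Fin n) (f : (Fin (n + 1) → Bool) → ℝ)
    (x : Fin n → Bool) :
    facet b (discreteDeriv i.succ f) x = discreteDeriv i (facet b f) x := by
  simp [facet, discreteDeriv, Fin.cons_update]

/-- A combination of the variance of `f` and of the fourth moments of its derivatives, which
dominates the loss accumulated in the induction on the dimension. -/
def energy (a c : ℝ) (f : (Fin n → Bool) → ℝ) : ℝ :=
  a * (cubeE (fun x => f x ^ 2) - cubeE f ^ 2) +
    c * ∑ i, cubeE (fun x => discreteDeriv i f x ^ 4)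

lemma energy_succ_ge {a c : ℝ} (hc : 0 ≤ c) (f : (Fin (n + 1) → Bool) → ℝ) :
    (energy a c (facet true f) + energy a c (facet false f)) / 2 +
      (a * ((cubeE (facet true f) - cubeE (facet false f)) / 2) ^ 2 +
        c * ((cubeE (facet true f) - cubeE (facet false f)) / 2) ^ 4) ≤ energy a c f := by
  have h₀ : ((cubeE (facet true f) - cubeE (facet false f)) / 2) ^ 4 ≤
      cubeE (fun x => discreteDeriv 0 f x ^ 4) := by
    have e : (cubeE (facet true f) - cubeE (facet false f)) / 2 =
        cubeE fun x => (facet true f x - facet false f x) / 2 := by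
      simp only [cubeE, ← Finset.sum_div, Finset.sum_sub_distrib]
      ring
    rw [e, cubeE_succ]
    refine (pow_four_cubeE_le _).trans (le_of_eq ?_)
    have : ∀ b, facet b (fun x => discreteDeriv 0 f x ^ 4) =
        fun x => ((facet true f x - facet false f x) / 2) ^ 4 := fun b => funext fun x => by
      rw [← facet_discreteDeriv_zero b]
      rfl
    rw [this, this]
    ring
  have h₁ : ∀ i : Fin n, cubeE (fun x => discreteDeriv i.succ f x ^ 4) =
      (cubeE (fun x => discreteDeriv i (facet true f) x ^ 4) +
        cubeE (fun x => discreteDeriv i (facet false f) x ^ 4)) / 2 := fun i => by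
    have : ∀ b, facet b (fun x => discreteDeriv i.succ f x ^ 4) =
        fun x => discreteDeriv i (facet b f) x ^ 4 := fun b => funext fun x => by
      rw [← facet_discreteDeriv_succ]
      rfl
    rw [cubeE_succ, this, this]
  have h₂ : cubeE (fun x => f x ^ 2) =
      (cubeE (fun x => facet true f x ^ 2) + cubeE (fun x => facet false f x ^ 2)) / 2 :=
    cubeE_succ _
  unfold energy
  rw [Fin.sum_univ_succ, h₂, cubeE_succ f]
  simp only [h₁, ← Finset.sum_div, Finset.sum_add_distrib]
  have := mul_le_mul_of_nonneg_left h₀ hc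
  linarith

lemma corrE_comp_le {ρ a c : ℝ} {J : ℝ → ℝ → ℝ} (h0 : 0 ≤ ρ) (h1 : ρ ≤ 1) (hc : 0 ≤ c)
    (hJ : FourPoint ρ J fun u => a * u ^ 2 + c * u ^ 4) (n : ℕ) :
    ∀ f g : (Fin n → Bool) → ℝ, (∀ x, f x ∈ Set.Icc (0 : ℝ) 1) → (∀ x, g x ∈ Set.Icc (0 : ℝ) 1) →
      corrE ρ (fun x y => J (f x) (g y)) ≤
        J (cubeE f) (cubeE g) + (energy a c f + energy a c g) := by
  induction n with
  | zero =>
    intro f g _ _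
    simp [corrE, cubeE, energy, corrWeight]
  | succ n ih =>
    intro f g hf hg
    have hf' : ∀ b x, facet b f x ∈ Set.Icc (0 : ℝ) 1 := fun b x => hf _
    have hg' : ∀ b x, facet b g x ∈ Set.Icc (0 : ℝ) 1 := fun b x => hg _
    have htt := ih _ _ (hf' true) (hg' true)
    have htf := ih _ _ (hf' true) (hg' false)
    have hft := ih _ _ (hf' false) (hg' true)
    have hff := ih _ _ (hf' false) (hg' false)
    have key := hJ ((cubeE (facet true f) + cubeE (facet false f)) / 2)
      ((cubeE (facet true g) + cubeE (facet false g)) / 2)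
      ((cubeE (facet true f) - cubeE (facet false f)) / 2)
      ((cubeE (facet true g) - cubeE (facet false g)) / 2)
    have e₁ : ∀ p q : ℝ, (p + q) / 2 + (p - q) / 2 = p := fun p q => by ring
    have e₂ : ∀ p q : ℝ, (p + q) / 2 - (p - q) / 2 = q := fun p q => by ring
    simp only [e₁, e₂] at key
    have key' := key (cubeE_mem_Icc (hf' _)) (cubeE_mem_Icc (hf' _)) (cubeE_mem_Icc (hg' _))
      (cubeE_mem_Icc (hg' _))
    have ef := energy_succ_ge (a := a) hc f
    have eg := energy_succ_ge (a := a) hc g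
    rw [corrE_succ, cubeE_succ f, cubeE_succ g]
    simp only [facet] at *
    have hρ : 0 ≤ (1 + ρ) / 4 := by linarith
    have hρ' : 0 ≤ (1 - ρ) / 4 := by linarith
    have m₁ := mul_le_mul_of_nonneg_left (add_le_add htt hff) hρ
    have m₂ := mul_le_mul_of_nonneg_left (add_le_add htf hft) hρ'
    linarith

end Expectation

section Fourier

variable {n : ℕ}

lemma chi_eq_prod_univ (S : Finset (Fin n)) (x : Fin n → Bool) :
    chi S x = ∏ i, if i ∈ S then sgn (x i) else 1 := by
  simp [chi, Finset.prod_ite_mem]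

lemma chi_empty (x : Fin n → Bool) : chi ∅ x = 1 := by simp [chi]

lemma cubeE_chi_mul_chi (S T : Finset (Fin n)) :
    cubeE (fun x => chi S x * chi T x) = if S = T then 1 else 0 := by
  have h : ∀ x : Fin n → Bool, chi S x * chi T x =
      ∏ i, (if i ∈ S then sgn (x i) else 1) * (if i ∈ T then sgn (x i) else 1) := fun x => by
    rw [Finset.prod_mul_distrib, chi_eq_prod_univ, chi_eq_prod_univ]
  have h' : ∀ i : Fin n, (if i ∈ S then sgn true else 1) * (if i ∈ T then sgn true else 1) +
      (if i ∈ S then sgn false else 1) * (if i ∈ T then sgn false else 1) =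
      if (i ∈ S ↔ i ∈ T) then 2 else 0 := fun i => by
    by_cases hS : i ∈ S <;> by_cases hT : i ∈ T <;> norm_num [hS, hT, sgn]
  simp only [cubeE, h]
  rw [sum_prod_bool fun i b => (if i ∈ S then sgn b else 1) * (if i ∈ T then sgn b else 1)]
  simp only [h']
  split_ifs with hST
  · simp [hST]
  · obtain ⟨i, hi⟩ : ∃ i, ¬(i ∈ S ↔ i ∈ T) := by
      by_contra! hc
      exact hST (Finset.ext hc)
    rw [Finset.prod_eq_zero (Finset.mem_univ i) (if_neg hi), zero_div]

/-- The multilinear polynomial with coefficients `c`. -/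
def fourierSum (c : Finset (Fin n) → ℝ) (x : Fin n → Bool) : ℝ := ∑ S, c S * chi S x

lemma fhat_fourierSum (c : Finset (Fin n) → ℝ) (S : Finset (Fin n)) :
    fhat (fourierSum c) S = c S := by
  simp only [fhat, fourierSum, Finset.sum_mul, mul_assoc]
  rw [cubeE_sum]
  simp only [cubeE_const_mul, cubeE_chi_mul_chi]
  simp

lemma cubeE_fourierSum_sq (c : Finset (Fin n) → ℝ) :
    cubeE (fun x => fourierSum c x ^ 2) = ∑ S, c S ^ 2 := by
  have h : ∀ x, fourierSum c x ^ 2 = ∑ S, c S * (fourierSum c x * chi S x) := fun x => by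
    rw [sq]
    nth_rw 2 [fourierSum]
    rw [Finset.mul_sum]
    exact Finset.sum_congr rfl fun S _ => by ring
  simp only [h]
  rw [cubeE_sum]
  refine Finset.sum_congr rfl fun S _ => ?_
  rw [cubeE_const_mul, sq]
  congr 1
  exact fhat_fourierSum c S

lemma corrWeight_eq_sum (ρ : ℝ) (x y : Fin n → Bool) :
    corrWeight ρ x y = (∑ S, ρ ^ S.card * (chi S x * chi S y)) / 4 ^ n := by
  have h := Finset.prod_one_add (Finset.univ : Finset (Fin n))
    (f := fun i => ρ * sgn (x i) * sgn (y i))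
  simp only [Finset.powerset_univ] at h
  rw [corrWeight, Finset.prod_div_distrib, h]
  simp [chi, Finset.prod_mul_distrib, mul_assoc]

lemma corrE_mul (ρ : ℝ) (f g : (Fin n → Bool) → ℝ) :
    corrE ρ (fun x y => f x * g y) = ∑ S, ρ ^ S.card * (fhat f S * fhat g S) := by
  have h : ∀ S, ρ ^ S.card * (fhat f S * fhat g S) =
      ∑ x, ∑ y, ρ ^ S.card * (chi S x * chi S y) / 4 ^ n * (f x * g y) := fun S => by
    rw [fhat, fhat, cubeE, cubeE, div_mul_div_comm, Finset.sum_mul_sum, ← mul_pow,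
      Finset.sum_div, Finset.mul_sum]
    refine Finset.sum_congr rfl fun x _ => ?_
    rw [Finset.sum_div, Finset.mul_sum]
    refine Finset.sum_congr rfl fun y _ => ?_
    norm_num
    ring
  simp only [h, corrE, corrWeight_eq_sum]
  rw [Finset.sum_comm]
  conv_rhs => rw [Finset.sum_comm]
  rw [Finset.sum_comm]
  refine Finset.sum_congr rfl fun x _ => ?_
  rw [Finset.sum_comm]
  refine Finset.sum_congr rfl fun y _ => ?_
  rw [Finset.sum_div, Finset.sum_mul]

lemma corrWeight_nonneg {ρ : ℝ} (h0 : 0 ≤ ρ) (h1 : ρ ≤ 1) (x y : Fin n → Bool) :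
    0 ≤ corrWeight ρ x y := by
  refine Finset.prod_nonneg fun i _ => ?_
  rw [mul_assoc]
  rcases sgn_mul_sgn_mem (x i) (y i) with h | h <;> rw [h] <;> linarith

lemma corrWeight_one (x y : Fin n → Bool) :
    corrWeight 1 x y = if x = y then 1 / 2 ^ n else 0 := by
  have h : ∀ a b : Bool, (1 + 1 * sgn a * sgn b) / 4 = if a = b then 1 / 2 else 0 := by
    intro a b
    cases a <;> cases b <;> norm_num [sgn]
  simp only [corrWeight, h]
  split_ifs with hxy
  · simp [hxy]
  · obtain ⟨i, hi⟩ := Function.ne_iff.mp hxy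
    exact Finset.prod_eq_zero (Finset.mem_univ i) (if_neg hi)

lemma corrE_mono {ρ : ℝ} (h0 : 0 ≤ ρ) (h1 : ρ ≤ 1) {F G : (Fin n → Bool) → (Fin n → Bool) → ℝ}
    (h : ∀ x y, F x y ≤ G x y) : corrE ρ F ≤ corrE ρ G :=
  Finset.sum_le_sum fun x _ => Finset.sum_le_sum fun y _ =>
    mul_le_mul_of_nonneg_left (h x y) (corrWeight_nonneg h0 h1 x y)

lemma corrE_add (ρ : ℝ) (F G : (Fin n → Bool) → (Fin n → Bool) → ℝ) :
    corrE ρ (fun x y => F x y + G x y) = corrE ρ F + corrE ρ G := by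
  simp [corrE, mul_add, Finset.sum_add_distrib]

/-- The noise operator `T_σ`. -/
def noise (σ : ℝ) (f : (Fin n → Bool) → ℝ) : (Fin n → Bool) → ℝ :=
  fourierSum fun S => σ ^ S.card * fhat f S

lemma noise_eq_sum (σ : ℝ) (f : (Fin n → Bool) → ℝ) (x : Fin n → Bool) :
    noise σ f x = 2 ^ n * ∑ y, corrWeight σ x y * f y := by
  simp only [noise, fourierSum, corrWeight_eq_sum, fhat, cubeE, Finset.sum_div, Finset.mul_sum,
    Finset.sum_mul]
  rw [Finset.sum_comm]
  refine Finset.sum_congr rfl fun y _ => Finset.sum_congr rfl fun S _ => ?_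
  have : (4 : ℝ) ^ n = 2 ^ n * 2 ^ n := by rw [← mul_pow]; norm_num
  rw [this]
  field_simp

lemma fourierSum_fhat (f : (Fin n → Bool) → ℝ) : fourierSum (fhat f) = f := by
  have h : fourierSum (fhat f) = noise 1 f := by simp [noise]
  ext x
  rw [h, noise_eq_sum]
  simp [corrWeight_one]

lemma sum_fhat_sq (f : (Fin n → Bool) → ℝ) :
    ∑ S, fhat f S ^ 2 = cubeE fun x => f x ^ 2 := by
  rw [← cubeE_fourierSum_sq, fourierSum_fhat]

lemma fhat_empty (f : (Fin n → Bool) → ℝ) : fhat f ∅ = cubeE f := by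
  simp [fhat, chi_empty]

lemma fhat_const_one (S : Finset (Fin n)) :
    fhat (fun _ => (1 : ℝ)) S = if S = ∅ then 1 else 0 := by
  have := cubeE_chi_mul_chi ∅ S
  simp only [chi_empty] at this
  rw [fhat, this]
  simp [eq_comm]

lemma noise_const_one (σ : ℝ) (x : Fin n → Bool) : noise σ (fun _ => (1 : ℝ)) x = 1 := by
  simp [noise, fourierSum, fhat_const_one, chi_empty]

lemma cubeE_noise (σ : ℝ) (f : (Fin n → Bool) → ℝ) : cubeE (noise σ f) = cubeE f := by
  rw [← fhat_empty, noise, fhat_fourierSum, ← fhat_empty]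
  simp

lemma noise_mem_Icc {σ : ℝ} (h0 : 0 ≤ σ) (h1 : σ ≤ 1) {f : (Fin n → Bool) → ℝ}
    (hf : ∀ x, f x ∈ Set.Icc (0 : ℝ) 1) (x : Fin n → Bool) : noise σ f x ∈ Set.Icc (0 : ℝ) 1 := by
  constructor
  · rw [noise_eq_sum]
    exact mul_nonneg (by positivity) (Finset.sum_nonneg fun y _ =>
      mul_nonneg (corrWeight_nonneg h0 h1 x y) (hf y).1)
  · rw [← noise_const_one σ x, noise_eq_sum, noise_eq_sum]
    gcongr with y
    · exact corrWeight_nonneg h0 h1 x y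
    · exact (hf y).2

lemma corrE_fst (ρ : ℝ) (f : (Fin n → Bool) → ℝ) : corrE ρ (fun x _ => f x) = cubeE f := by
  have := corrE_mul ρ f fun _ => 1
  simpa [fhat_const_one, fhat_empty] using this

lemma corrE_snd (ρ : ℝ) (f : (Fin n → Bool) → ℝ) : corrE ρ (fun _ y => f y) = cubeE f := by
  have := corrE_mul ρ (fun _ => 1) f
  simpa [fhat_const_one, fhat_empty] using this

lemma corrE_const (ρ a : ℝ) : corrE ρ (fun _ _ : Fin n → Bool => a) = a := by
  rw [corrE_fst ρ fun _ => a, cubeE_const]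

lemma corrE_noise {ρ σ : ℝ} (hσ : σ ≠ 0) (f : (Fin n → Bool) → ℝ) :
    corrE (ρ / σ ^ 2) (fun x y => noise σ f x * noise σ f y) = corrE ρ fun x y => f x * f y := by
  rw [corrE_mul, corrE_mul]
  refine Finset.sum_congr rfl fun S _ => ?_
  rw [noise, fhat_fourierSum, div_pow]
  field_simp
  ring

end Fourier

section Hypercontractivity

variable {n : ℕ}

lemma cubeE_sgn_mul_eq_zero (a : Fin n) {h : (Fin n → Bool) → ℝ}
    (hh : ∀ x b, h (Function.update x a b) = h x) : cubeE (fun x => sgn (x a) * h x) = 0 := by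
  have inv : Function.Involutive fun x : Fin n → Bool => Function.update x a (!x a) := fun x => by
    simp
  have e := Equiv.sum_comp (inv.toPerm _) fun x => sgn (x a) * h x
  have hs : ∀ b : Bool, sgn (!b) = -sgn b := by intro b; cases b <;> simp [sgn]
  simp only [Function.Involutive.coe_toPerm, Function.update_self, hh, hs, neg_mul,
    Finset.sum_neg_distrib] at e
  rw [cubeE, show ∑ x : Fin n → Bool, sgn (x a) * h x = 0 by linarith, zero_div]

lemma chi_insert {a : Fin n} {S : Finset (Fin n)} (ha : a ∉ S) (x : Fin n → Bool) :
    chi (insert a S) x = sgn (x a) * chi S x :=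
  Finset.prod_insert ha

lemma chi_update_of_notMem {a : Fin n} {S : Finset (Fin n)} (ha : a ∉ S) (x : Fin n → Bool)
    (b : Bool) : chi S (Function.update x a b) = chi S x :=
  Finset.prod_congr rfl fun i hi => by
    rw [Function.update_of_ne (ne_of_mem_of_not_mem hi ha)]

lemma cubeE_pow_four_powerset_le (A : Finset (Fin n)) :
    ∀ c : Finset (Fin n) → ℝ, cubeE (fun x => (∑ S ∈ A.powerset, c S * chi S x) ^ 4) ≤
      (∑ S ∈ A.powerset, 3 ^ S.card * c S ^ 2) ^ 2 := by
  induction A using Finset.induction_on with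
  | empty =>
    intro c
    simp only [Finset.powerset_empty, Finset.sum_singleton, chi_empty, cubeE_const]
    simp [← pow_mul]
  | insert a A ha ih =>
    intro c
    have notMem : ∀ S ∈ A.powerset, a ∉ S := fun S hS h => ha (Finset.mem_powerset.mp hS h)
    set r : (Fin n → Bool) → ℝ := fun x => ∑ S ∈ A.powerset, c S * chi S x with hr
    set q : (Fin n → Bool) → ℝ := fun x => ∑ S ∈ A.powerset, c (insert a S) * chi S x with hq
    set R := ∑ S ∈ A.powerset, 3 ^ S.card * c S ^ 2 with hR
    set Q := ∑ S ∈ A.powerset, 3 ^ S.card * c (insert a S) ^ 2 with hQ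
    have hr4 : cubeE (fun x => r x ^ 4) ≤ R ^ 2 := ih c
    have hq4 : cubeE (fun x => q x ^ 4) ≤ Q ^ 2 := ih fun S => c (insert a S)
    have hR0 : 0 ≤ R := Finset.sum_nonneg fun S _ => by positivity
    have hQ0 : 0 ≤ Q := Finset.sum_nonneg fun S _ => by positivity
    have hru : ∀ x b, r (Function.update x a b) = r x := fun x b =>
      Finset.sum_congr rfl fun S hS => by rw [chi_update_of_notMem (notMem S hS)]
    have hqu : ∀ x b, q (Function.update x a b) = q x := fun x b =>
      Finset.sum_congr rfl fun S hS => by rw [chi_update_of_notMem (notMem S hS)]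
    have hp : ∀ x, ∑ S ∈ (insert a A).powerset, c S * chi S x = r x + sgn (x a) * q x := fun x => by
      rw [Finset.sum_powerset_insert ha, hr, hq]
      simp only [Finset.mul_sum]
      congr 1
      refine Finset.sum_congr rfl fun S hS => ?_
      rw [chi_insert (notMem S hS)]
      ring
    have hw : ∑ S ∈ (insert a A).powerset, 3 ^ S.card * c S ^ 2 = R + 3 * Q := by
      rw [Finset.sum_powerset_insert ha, hQ, Finset.mul_sum]
      congr 1
      refine Finset.sum_congr rfl fun S hS => ?_
      rw [Finset.card_insert_of_notMem (notMem S hS)]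
      ring
    have hexp : ∀ x, (r x + sgn (x a) * q x) ^ 4 =
        r x ^ 4 + 6 * (r x ^ 2 * q x ^ 2) + q x ^ 4 +
          sgn (x a) * (4 * r x ^ 3 * q x + 4 * r x * q x ^ 3) := fun x => by
      have hs := sgn_sq (x a)
      linear_combination (6 * r x ^ 2 * q x ^ 2 + 4 * r x * sgn (x a) * q x ^ 3 +
        q x ^ 4 * (sgn (x a) ^ 2 + 1)) * hs
    have hrq : cubeE (fun x => r x ^ 2 * q x ^ 2) ≤ R * Q := by
      refine le_of_sq_le_sq ?_ (mul_nonneg hR0 hQ0)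
      refine (sq_cubeE_mul_le _ _).trans ?_
      simp only [← pow_mul]
      rw [mul_pow]
      exact mul_le_mul hr4 hq4 (cubeE_nonneg fun x => Even.pow_nonneg (by decide) _) (sq_nonneg R)
    simp only [hp, hw, hexp]
    rw [cubeE_add, cubeE_add, cubeE_add, cubeE_const_mul,
      cubeE_sgn_mul_eq_zero a fun x b => by rw [hru, hqu]]
    nlinarith [sq_nonneg Q]

/-- Bonami's hypercontractive inequality for fourth moments. -/
lemma cubeE_fourierSum_pow_four_le (c : Finset (Fin n) → ℝ) :
    cubeE (fun x => fourierSum c x ^ 4) ≤ (∑ S, 3 ^ S.card * c S ^ 2) ^ 2 := by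
  simpa [fourierSum] using cubeE_pow_four_powerset_le Finset.univ c

end Hypercontractivity

section Smallness

variable {n : ℕ}

/-- The Fourier coefficients of `T_σ f` on the sets containing `i`. -/
def noiseCoeffAt (i : Fin n) (σ : ℝ) (f : (Fin n → Bool) → ℝ) (S : Finset (Fin n)) : ℝ :=
  if i ∈ S then σ ^ S.card * fhat f S else 0

lemma chi_update_of_mem {i : Fin n} {S : Finset (Fin n)} (hi : i ∈ S) (x : Fin n → Bool)
    (b : Bool) : chi S (Function.update x i b) = sgn b * chi (S.erase i) x := by
  conv_lhs => rw [← Finset.insert_erase hi]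
  rw [chi_insert (Finset.notMem_erase i S), chi_update_of_notMem (Finset.notMem_erase i S),
    Function.update_self]

lemma sgn_mul_discreteDeriv_noise (i : Fin n) (σ : ℝ) (f : (Fin n → Bool) → ℝ)
    (x : Fin n → Bool) :
    sgn (x i) * discreteDeriv i (noise σ f) x = fourierSum (noiseCoeffAt i σ f) x := by
  simp only [discreteDeriv, noise, fourierSum, noiseCoeffAt]
  rw [← Finset.sum_sub_distrib, Finset.sum_div, Finset.mul_sum]
  refine Finset.sum_congr rfl fun S _ => ?_
  split_ifs with hi
  · have e : chi S x = sgn (x i) * chi (S.erase i) x := by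
      rw [← chi_update_of_mem hi x (x i), Function.update_eq_self]
    rw [chi_update_of_mem hi, chi_update_of_mem hi, e]
    simp only [sgn]
    norm_num
  · rw [chi_update_of_notMem hi, chi_update_of_notMem hi]
    simp

lemma discreteDeriv_pow_four (i : Fin n) (σ : ℝ) (f : (Fin n → Bool) → ℝ) (x : Fin n → Bool) :
    discreteDeriv i (noise σ f) x ^ 4 = fourierSum (noiseCoeffAt i σ f) x ^ 4 := by
  rw [← sgn_mul_discreteDeriv_noise, mul_pow, show (4 : ℕ) = 2 * 2 from rfl, pow_mul (sgn _),
    sgn_sq, one_pow, one_mul]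

lemma fourierSum_noiseCoeffAt_sq_le {σ : ℝ} (h0 : 0 ≤ σ) (h1 : σ ≤ 1) {f : (Fin n → Bool) → ℝ}
    (hf : ∀ x, f x ∈ Set.Icc (0 : ℝ) 1) (i : Fin n) (x : Fin n → Bool) :
    fourierSum (noiseCoeffAt i σ f) x ^ 2 ≤ 1 := by
  rw [← sgn_mul_discreteDeriv_noise, mul_pow, sgn_sq, one_mul, sq_le_one_iff_abs_le_one, abs_le,
    discreteDeriv]
  have ht := noise_mem_Icc h0 h1 hf (Function.update x i true)
  have hf := noise_mem_Icc h0 h1 hf (Function.update x i false)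
  constructor <;> linarith [ht.1, ht.2, hf.1, hf.2]

lemma add_pow_four_le {l h : ℝ} (H : (l + h) ^ 2 ≤ 1) : (l + h) ^ 4 ≤ 4 * l ^ 4 + 4 * h ^ 2 := by
  have h₁ : (l + h) ^ 2 ≤ 2 * l ^ 2 + 2 * h ^ 2 := by nlinarith [sq_nonneg (l - h)]
  have h₂ := mul_le_mul_of_nonneg_left h₁ (sq_nonneg (l + h))
  nlinarith [sq_nonneg ((l + h) ^ 2 - 2 * l ^ 2), mul_le_mul_of_nonneg_right H (sq_nonneg h)]

lemma cubeE_discreteDeriv_noise_pow_four_le {σ τ : ℝ} (h0 : 0 ≤ σ) (h1 : σ ≤ 1)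
    {f : (Fin n → Bool) → ℝ} (hf : ∀ x, f x ∈ Set.Icc (0 : ℝ) 1) (i : Fin n)
    (hi : influence f i ≤ τ) (d : ℕ) :
    cubeE (fun x => discreteDeriv i (noise σ f) x ^ 4) ≤
      4 * 9 ^ d * τ * ∑ S, noiseCoeffAt i σ f S ^ 2 +
        4 * ∑ S with d < S.card, noiseCoeffAt i σ f S ^ 2 := by
  set w := noiseCoeffAt i σ f with hw
  set lo : Finset (Fin n) → ℝ := fun S => if S.card ≤ d then w S else 0 with hlo
  set hi' : Finset (Fin n) → ℝ := fun S => if d < S.card then w S else 0 with hhi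
  have hsplit : ∀ x, fourierSum w x = fourierSum lo x + fourierSum hi' x := fun x => by
    simp only [fourierSum]
    rw [← Finset.sum_add_distrib]
    refine Finset.sum_congr rfl fun S _ => ?_
    rcases le_or_gt S.card d with h | h
    · simp [hlo, hhi, h, not_lt.mpr h]
    · simp [hlo, hhi, h, not_le.mpr h]
  have hpt : ∀ x, discreteDeriv i (noise σ f) x ^ 4 ≤
      4 * fourierSum lo x ^ 4 + 4 * fourierSum hi' x ^ 2 := fun x => by
    rw [discreteDeriv_pow_four, ← hw, hsplit]
    refine add_pow_four_le ?_
    rw [← hsplit]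
    exact fourierSum_noiseCoeffAt_sq_le h0 h1 hf i x
  have hW0 : 0 ≤ ∑ S, w S ^ 2 := Finset.sum_nonneg fun S _ => sq_nonneg _
  have hWτ : ∑ S, w S ^ 2 ≤ τ := by
    refine le_trans ?_ hi
    rw [influence, Finset.powerset_univ, Finset.sum_filter]
    refine Finset.sum_le_sum fun S _ => ?_
    simp only [hw, noiseCoeffAt]
    split_ifs
    · rw [mul_pow]
      exact mul_le_of_le_one_left (sq_nonneg _) (pow_le_one₀ (by positivity) (pow_le_one₀ h0 h1))
    · simp
  have hlow : ∑ S, 3 ^ S.card * lo S ^ 2 ≤ 3 ^ d * ∑ S, w S ^ 2 := by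
    rw [Finset.mul_sum]
    refine Finset.sum_le_sum fun S _ => ?_
    simp only [hlo]
    split_ifs with h
    · gcongr
      norm_num
    · simp only [ne_eq, OfNat.ofNat_ne_zero, not_false_eq_true, zero_pow, mul_zero]
      positivity
  have hlow4 : cubeE (fun x => fourierSum lo x ^ 4) ≤ 9 ^ d * τ * ∑ S, w S ^ 2 := by
    refine (cubeE_fourierSum_pow_four_le lo).trans ?_
    calc (∑ S, 3 ^ S.card * lo S ^ 2) ^ 2 ≤ (3 ^ d * ∑ S, w S ^ 2) ^ 2 := by
          gcongr
      _ = 9 ^ d * (∑ S, w S ^ 2) * ∑ S, w S ^ 2 := by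
          rw [mul_pow, ← pow_mul, mul_comm d, pow_mul]
          norm_num
          ring
      _ ≤ 9 ^ d * τ * ∑ S, w S ^ 2 := by gcongr
  have hhigh : cubeE (fun x => fourierSum hi' x ^ 2) = ∑ S with d < S.card, w S ^ 2 := by
    rw [cubeE_fourierSum_sq, Finset.sum_filter]
    refine Finset.sum_congr rfl fun S _ => ?_
    simp only [hhi]
    split_ifs <;> simp
  refine (cubeE_mono hpt).trans ?_
  rw [cubeE_add, cubeE_const_mul, cubeE_const_mul, hhigh]
  linarith

lemma sum_noiseCoeffAt_sq (σ : ℝ) (f : (Fin n → Bool) → ℝ) (S : Finset (Fin n)) :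
    ∑ i, noiseCoeffAt i σ f S ^ 2 = S.card * (σ ^ 2) ^ S.card * fhat f S ^ 2 := by
  have : ∀ i, noiseCoeffAt i σ f S ^ 2 = if i ∈ S then (σ ^ 2) ^ S.card * fhat f S ^ 2 else 0 :=
    fun i => by
      simp only [noiseCoeffAt]
      split_ifs
      · ring
      · simp
  simp only [this]
  rw [Finset.sum_ite_mem, Finset.univ_inter, Finset.sum_const, nsmul_eq_mul, mul_assoc]

lemma exists_sum_cubeE_discreteDeriv_noise_le {σ θ : ℝ} (h0 : 0 ≤ σ) (h1 : σ < 1) (hθ : 0 < θ) :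
    ∃ τ : ℝ, 0 < τ ∧ ∀ (n : ℕ) (f : (Fin n → Bool) → ℝ), (∀ x, f x ∈ Set.Icc (0 : ℝ) 1) →
      (∀ i, influence f i ≤ τ) →
      ∑ i, cubeE (fun x => discreteDeriv i (noise σ f) x ^ 4) ≤ θ := by
  have hσ2 : σ ^ 2 < 1 := by nlinarith
  have hlim : Filter.Tendsto (fun k : ℕ => (k : ℝ) * (σ ^ 2) ^ k) Filter.atTop (nhds 0) :=
    tendsto_self_mul_const_pow_of_lt_one (sq_nonneg σ) hσ2
  obtain ⟨K, hK⟩ := hlim.bddAbove_range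
  have hK' : ∀ k : ℕ, (k : ℝ) * (σ ^ 2) ^ k ≤ max K 1 := fun k =>
    (hK ⟨k, rfl⟩).trans (le_max_left _ _)
  set M := max K 1
  have hM : 0 < M := lt_of_lt_of_le one_pos (le_max_right _ _)
  obtain ⟨d, hd⟩ := Filter.eventually_atTop.mp
    (hlim.eventually (ge_mem_nhds (show (0 : ℝ) < θ / 8 by positivity)))
  refine ⟨θ / (8 * 9 ^ d * M), by positivity, fun n f hf hinf => ?_⟩
  have hpars : ∑ S, fhat f S ^ 2 ≤ 1 := by
    rw [sum_fhat_sq]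
    refine (cubeE_mono (g := fun _ => 1) fun x => ?_).trans_eq (cubeE_const 1)
    exact pow_le_one₀ (hf x).1 (hf x).2
  have hall : ∑ i, ∑ S, noiseCoeffAt i σ f S ^ 2 ≤ M := by
    rw [Finset.sum_comm]
    simp only [sum_noiseCoeffAt_sq]
    calc ∑ S : Finset (Fin n), (S.card : ℝ) * (σ ^ 2) ^ S.card * fhat f S ^ 2
        ≤ ∑ S, M * fhat f S ^ 2 := by
          gcongr with S
          exact hK' _
      _ = M * ∑ S, fhat f S ^ 2 := by rw [Finset.mul_sum]
      _ ≤ M := mul_le_of_le_one_right hM.le hpars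
  have hhigh : ∑ i, ∑ S with d < S.card, noiseCoeffAt i σ f S ^ 2 ≤ θ / 8 := by
    rw [Finset.sum_comm]
    simp only [sum_noiseCoeffAt_sq]
    calc ∑ S : Finset (Fin n) with d < S.card, (S.card : ℝ) * (σ ^ 2) ^ S.card * fhat f S ^ 2
        ≤ ∑ S with d < S.card, θ / 8 * fhat f S ^ 2 := by
          refine Finset.sum_le_sum fun S hS => ?_
          gcongr
          exact hd _ (Finset.mem_filter.mp hS).2.le
      _ ≤ ∑ S, θ / 8 * fhat f S ^ 2 :=
          Finset.sum_le_sum_of_subset_of_nonneg (Finset.filter_subset _ _)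
            fun S _ _ => by positivity
      _ = θ / 8 * ∑ S, fhat f S ^ 2 := by rw [Finset.mul_sum]
      _ ≤ θ / 8 := mul_le_of_le_one_right (by positivity) hpars
  calc ∑ i, cubeE (fun x => discreteDeriv i (noise σ f) x ^ 4)
      ≤ ∑ i, (4 * 9 ^ d * (θ / (8 * 9 ^ d * M)) * ∑ S, noiseCoeffAt i σ f S ^ 2 +
        4 * ∑ S with d < S.card, noiseCoeffAt i σ f S ^ 2) :=
        Finset.sum_le_sum fun i _ =>
          cubeE_discreteDeriv_noise_pow_four_le h0 h1.le hf i (hinf i) d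
    _ = 4 * 9 ^ d * (θ / (8 * 9 ^ d * M)) * ∑ i, ∑ S, noiseCoeffAt i σ f S ^ 2 +
        4 * ∑ i, ∑ S with d < S.card, noiseCoeffAt i σ f S ^ 2 := by
        rw [Finset.sum_add_distrib, Finset.mul_sum, Finset.mul_sum]
    _ ≤ 4 * 9 ^ d * (θ / (8 * 9 ^ d * M)) * M + 4 * (θ / 8) := by gcongr
    _ = θ := by
        field_simp
        norm_num

end Smallness

section Stability

variable {n : ℕ}

lemma noiseStab_eq {f : (Fin n → Bool) → ℝ} (hf : cubeE f = 1 / 2) (ρ : ℝ) :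
    noiseStab ρ f = 2 * corrE ρ fun x y => f x * f y := by
  have h : ∀ x y, f x * f y + (1 - f x) * (1 - f y) =
      f x * (2 * f y) + ((1 + -1 * f x) + -1 * f y) := fun x y => by ring
  have e : corrE ρ (fun x y => f x * (2 * f y)) = 2 * corrE ρ fun x y => f x * f y := by
    simp only [corrE, Finset.mul_sum]
    exact Finset.sum_congr rfl fun x _ => Finset.sum_congr rfl fun y _ => by ring
  simp only [noiseStab, h]
  rw [corrE_add, corrE_add, corrE_snd ρ fun y => -1 * f y,
    corrE_fst ρ fun x => 1 + -1 * f x, cubeE_add, cubeE_const_mul, cubeE_const, hf, e]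
  ring

lemma noiseStab_le_one {ρ : ℝ} (h0 : 0 ≤ ρ) (h1 : ρ ≤ 1) {f : (Fin n → Bool) → ℝ}
    (hf : ∀ x, f x ∈ Set.Icc (0 : ℝ) 1) : noiseStab ρ f ≤ 1 := by
  refine (corrE_mono h0 h1 fun x y => ?_).trans_eq (corrE_const ρ 1)
  obtain ⟨hx0, hx1⟩ := hf x
  obtain ⟨hy0, hy1⟩ := hf y
  nlinarith [mul_nonneg hx0 (sub_nonneg.mpr hy1), mul_nonneg hy0 (sub_nonneg.mpr hx1)]

lemma energy_le {a c θ : ℝ} (ha : 0 ≤ a) (hc : 0 ≤ c) {f : (Fin n → Bool) → ℝ}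
    (hf : ∀ x, f x ∈ Set.Icc (0 : ℝ) 1)
    (hθ : ∑ i, cubeE (fun x => discreteDeriv i f x ^ 4) ≤ θ) : energy a c f ≤ a + c * θ := by
  have h : cubeE (fun x => f x ^ 2) ≤ 1 :=
    (cubeE_mono (g := fun _ => 1) fun x => pow_le_one₀ (hf x).1 (hf x).2).trans_eq (cubeE_const 1)
  have h' : a * (cubeE (fun x => f x ^ 2) - cubeE f ^ 2) ≤ a :=
    mul_le_of_le_one_right ha (by linarith [sq_nonneg (cubeE f)])
  exact add_le_add h' (mul_le_mul_of_nonneg_left hθ hc)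

lemma exists_noise_parameter {ρ ε : ℝ} (h1 : ρ < 1) (hε : 0 < ε) :
    ∃ σ : ℝ, 0 < σ ∧ σ < 1 ∧ ρ / σ ^ 2 < 1 ∧
      Real.arcsin (ρ / σ ^ 2) / Real.pi < Real.arcsin ρ / Real.pi + ε := by
  have hc : ContinuousAt (fun σ : ℝ => ρ / σ ^ 2) 1 :=
    continuousAt_const.div (continuousAt_id.pow 2) (by norm_num)
  have hc' : ContinuousAt (fun σ : ℝ => Real.arcsin (ρ / σ ^ 2) / Real.pi) 1 :=
    (Real.continuous_arcsin.continuousAt.comp hc).div_const _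
  have e₁ : ∀ᶠ σ : ℝ in nhds 1, ρ / σ ^ 2 < 1 := hc.eventually_lt_const (by simpa using h1)
  have e₂ : ∀ᶠ σ : ℝ in nhds 1,
      Real.arcsin (ρ / σ ^ 2) / Real.pi < Real.arcsin ρ / Real.pi + ε :=
    hc'.eventually_lt_const (by simpa using hε)
  have e₃ : ∀ᶠ σ : ℝ in nhdsWithin 1 (Set.Iio 1), σ ∈ Set.Ioo (0 : ℝ) 1 :=
    Ioo_mem_nhdsLT one_pos
  obtain ⟨σ, ⟨h, h'⟩, h''⟩ :=
    (((e₁.and e₂).filter_mono nhdsWithin_le_nhds).and e₃).exists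
  exact ⟨σ, h''.1, h''.2, h, h'⟩

end Stability

/-- **Majority is Stablest** (Theorem 1.1). -/
theorem majority_is_stablest (ρ : ℝ) (hρ0 : 0 ≤ ρ) (hρ1 : ρ ≤ 1) (ε : ℝ) (hε : 0 < ε) :
    ∃ τ : ℝ, 0 < τ ∧ ∀ (n : ℕ) (f : (Fin n → Bool) → ℝ),
      (∀ x, f x ∈ Set.Icc (0 : ℝ) 1) → cubeE f = 1 / 2 →
      (∀ i, influence f i ≤ τ) →
      noiseStab ρ f ≤ 1 - Real.arccos ρ / Real.pi + ε := by
  rcases hρ1.eq_or_lt with rfl | hρ1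
  · refine ⟨1, one_pos, fun n f hf _ _ => (noiseStab_le_one hρ0 le_rfl hf).trans ?_⟩
    simp [hε.le]
  have hε4 : 0 < ε / 4 := by positivity
  obtain ⟨σ, hσ0, hσ1, hρσ, harcsin⟩ := exists_noise_parameter hρ1 hε4
  have hρσ0 : 0 ≤ ρ / σ ^ 2 := by positivity
  obtain ⟨δ, hδ0, hδ⟩ : ∃ δ : ℝ, 0 < δ ∧ δ < min (1 / 2) (ε / 16) :=
    exists_between (by positivity)
  have hδ' : δ < 1 / 2 := hδ.trans_le (min_le_left _ _)
  have hδε : δ < ε / 16 := hδ.trans_le (min_le_right _ _)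
  have ha : 0 < ε / 16 := by positivity
  obtain ⟨c, hc, hJ⟩ := exists_fourPoint_gaussJ hρσ0 hρσ hδ0 hδ' ha
  have hθ : 0 < ε / (16 * (c + 1)) := by positivity
  obtain ⟨τ, hτ, hsmall⟩ := exists_sum_cubeE_discreteDeriv_noise_le hσ0.le hσ1 hθ
  refine ⟨τ, hτ, fun n f hf hmean hinf => ?_⟩
  have hg : ∀ x, noise σ f x ∈ Set.Icc (0 : ℝ) 1 := noise_mem_Icc hσ0.le hσ1.le hf
  have henergy : energy (ε / 16) c (noise σ f) ≤ ε / 8 := by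
    refine (energy_le ha.le hc hg (hsmall n f hf hinf)).trans ?_
    have : c * (ε / (16 * (c + 1))) ≤ ε / 16 := by
      rw [mul_div_assoc', div_le_div_iff₀ (by positivity) (by positivity)]
      nlinarith
    linarith
  have hcorr : corrE (ρ / σ ^ 2) (fun x y => noise σ f x * noise σ f y) ≤
      corrE (ρ / σ ^ 2) (fun x y => gaussJ (ρ / σ ^ 2) δ (noise σ f x) (noise σ f y)) +
        2 * δ := by
    rw [← corrE_const (n := n) (ρ / σ ^ 2) (2 * δ), ← corrE_add]
    exact corrE_mono hρσ0 hρσ.le fun x y => by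
      linarith [mul_sub_le_gaussJ hρσ0 hδ0 hδ' (hg x) (hg y)]
  have hmain := corrE_comp_le hρσ0 hρσ.le hc hJ n _ _ hg hg
  rw [cubeE_noise, hmean, gaussJ_half hρσ0 hρσ] at hmain
  have e₁ : Real.arcsin (ρ / σ ^ 2) / (2 * Real.pi) =
      Real.arcsin (ρ / σ ^ 2) / Real.pi / 2 := by
    rw [div_div, mul_comm Real.pi]
  have e₂ : 1 - Real.arccos ρ / Real.pi = 1 / 2 + Real.arcsin ρ / Real.pi := by
    have := Real.pi_ne_zero
    rw [Real.arccos_eq_pi_div_two_sub_arcsin]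
    field_simp
    ring
  rw [noiseStab_eq hmean, ← corrE_noise hσ0.ne', e₂]
  linarith

end DMN
end
end

section
/- (Base case, Claim 3.3) For every 0 < ρ < 1 there is a constant C(ρ) > 0 such that for every ε > 0 and any two (jointly distributed) random variables X, Y taking values in [ε, 1−ε] whose correlation coefficient lies in [0, ρ] (i.e., E[(X−EX)(Y−EY)] = σ·√(Var X · Var Y) for some σ ∈ [0, ρ]), one has E[J_ρ(X, Y)] ≤ J_ρ(E X, E Y) + C(ρ)·ε^{−C(ρ)}·(E|X − E X|³ + E|Y − E Y|³). -/
open MeasureTheory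

noncomputable section
namespace DMN

/-- The standard normal CDF `Φ`. -/
def Phi (t : ℝ) : ℝ := ∫ s in Set.Iic t, Real.exp (-s ^ 2 / 2) / Real.sqrt (2 * Real.pi)

/-- The inverse of the standard normal CDF. -/
def PhiInv : ℝ → ℝ := Function.invFun Phi

/-- `J_ρ(x,y) = P[X ≤ Φ⁻¹(x), Y ≤ Φ⁻¹(y)]` for a centered bivariate Gaussian `(X,Y)`
with unit variances and covariance `ρ`, extended continuously to the boundary of
`[0,1]²`. -/
def J (ρ x y : ℝ) : ℝ :=
  if x = 0 ∨ y = 0 then 0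
  else if x = 1 then y
  else if y = 1 then x
  else
    ∫ s in Set.Iic (PhiInv x), ∫ t in Set.Iic (PhiInv y),
      Real.exp (-(s ^ 2 - 2 * ρ * s * t + t ^ 2) / (2 * (1 - ρ ^ 2))) /
        (2 * Real.pi * Real.sqrt (1 - ρ ^ 2))

/-- The standard normal density. -/
def phi (t : ℝ) : ℝ := Real.exp (-t ^ 2 / 2) / Real.sqrt (2 * Real.pi)

lemma phi_pos (t : ℝ) : 0 < phi t := by unfold phi; positivity

lemma continuous_phi : Continuous phi := by unfold phi; fun_prop

lemma phi_eq_gaussianPDFReal : phi = ProbabilityTheory.gaussianPDFReal 0 1 := by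
  ext t
  simp [phi, ProbabilityTheory.gaussianPDFReal]
  ring

lemma integrable_phi : Integrable phi := by
  rw [phi_eq_gaussianPDFReal]
  exact ProbabilityTheory.integrable_gaussianPDFReal 0 1

lemma hasDerivAt_phi (t : ℝ) : HasDerivAt phi (-t * phi t) t := by
  have h := ((((hasDerivAt_id t).pow 2).neg.div_const 2).exp).div_const (Real.sqrt (2 * Real.pi))
  refine h.congr_deriv ?_
  simp only [phi, id_eq, Pi.neg_apply, Pi.pow_apply]
  ring

lemma Phi_eq_integral_phi (t : ℝ) : Phi t = ∫ s in Set.Iic t, phi s := rfl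

lemma Phi_eq_measureReal (t : ℝ) :
    Phi t = (ProbabilityTheory.gaussianReal 0 1).real (Set.Iic t) := by
  rw [Phi_eq_integral_phi, phi_eq_gaussianPDFReal, measureReal_def,
    ProbabilityTheory.gaussianReal_apply_eq_integral 0 one_ne_zero, ENNReal.toReal_ofReal]
  exact integral_nonneg fun x => ProbabilityTheory.gaussianPDFReal_nonneg 0 1 x

lemma Phi_eq_cdf (t : ℝ) :
    Phi t = ProbabilityTheory.cdf (ProbabilityTheory.gaussianReal 0 1) t := by
  rw [ProbabilityTheory.cdf_eq_real, Phi_eq_measureReal]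

lemma hasDerivAt_integral_Iic {f : ℝ → ℝ} (hf : Integrable f) (hc : Continuous f) (a : ℝ) :
    HasDerivAt (fun x => ∫ s in Set.Iic x, f s) (f a) a := by
  have h := (intervalIntegral.integral_hasDerivAt_right (hf.intervalIntegrable (a := 0) (b := a))
    hc.stronglyMeasurable.stronglyMeasurableAtFilter hc.continuousAt).const_add
      (∫ s in Set.Iic (0 : ℝ), f s)
  refine h.congr_of_eventuallyEq (Filter.Eventually.of_forall fun x => ?_)
  have := intervalIntegral.integral_Iic_sub_Iic (hf.integrableOn (s := Set.Iic (0 : ℝ)))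
    (hf.integrableOn (s := Set.Iic x))
  simp only [← this]
  ring

lemma hasDerivAt_Phi (t : ℝ) : HasDerivAt Phi (phi t) t :=
  hasDerivAt_integral_Iic integrable_phi continuous_phi t

lemma continuous_Phi : Continuous Phi :=
  continuous_iff_continuousAt.2 fun t => (hasDerivAt_Phi t).continuousAt

lemma strictMono_Phi : StrictMono Phi :=
  strictMono_of_hasDerivAt_pos hasDerivAt_Phi phi_pos

lemma exists_Phi_eq {x : ℝ} (hx : x ∈ Set.Ioo (0 : ℝ) 1) : ∃ t, Phi t = x := by
  have hbot : Filter.Tendsto Phi Filter.atBot (nhds 0) := by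
    simpa only [funext Phi_eq_cdf] using ProbabilityTheory.tendsto_cdf_atBot _
  have htop : Filter.Tendsto Phi Filter.atTop (nhds 1) := by
    simpa only [funext Phi_eq_cdf] using ProbabilityTheory.tendsto_cdf_atTop _
  exact mem_range_of_exists_le_of_exists_ge continuous_Phi
    ((hbot.eventually_lt_const hx.1).exists.imp fun _ h => h.le)
    ((htop.eventually_const_lt hx.2).exists.imp fun _ h => h.le)

lemma Phi_PhiInv {x : ℝ} (hx : x ∈ Set.Ioo (0 : ℝ) 1) : Phi (PhiInv x) = x :=
  Function.invFun_eq (exists_Phi_eq hx)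

lemma hasDerivAt_PhiInv {x : ℝ} (hx : x ∈ Set.Ioo (0 : ℝ) 1) :
    HasDerivAt PhiInv (phi (PhiInv x))⁻¹ x := by
  have hs : HasStrictDerivAt Phi (phi (PhiInv x)) (PhiInv x) :=
    hasStrictDerivAt_of_hasDerivAt_of_continuousAt (Filter.Eventually.of_forall hasDerivAt_Phi)
      continuous_phi.continuousAt
  have h := (hs.to_local_left_inverse (phi_pos _).ne' (g := PhiInv) <|
    Filter.Eventually.of_forall
      (Function.leftInverse_invFun strictMono_Phi.injective)).hasDerivAt
  rwa [Phi_PhiInv hx] at h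

lemma Phi_le_exp {t : ℝ} (ht : t ≤ 0) : Phi t ≤ Real.exp (-t ^ 2 / 2) := by
  have h := ProbabilityTheory.measure_le_le_exp_mul_mgf
    (μ := ProbabilityTheory.gaussianReal 0 1) (X := id) t ht
    (ProbabilityTheory.integrable_exp_mul_gaussianReal t)
  rw [ProbabilityTheory.mgf_id_gaussianReal, ← Real.exp_add] at h
  rw [Phi_eq_measureReal]
  refine h.trans_eq (congrArg _ ?_)
  simp
  ring

lemma one_sub_Phi_le_exp {t : ℝ} (ht : 0 ≤ t) : 1 - Phi t ≤ Real.exp (-t ^ 2 / 2) := by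
  have h := ProbabilityTheory.measure_ge_le_exp_mul_mgf
    (μ := ProbabilityTheory.gaussianReal 0 1) (X := id) t ht
    (ProbabilityTheory.integrable_exp_mul_gaussianReal t)
  rw [ProbabilityTheory.mgf_id_gaussianReal, ← Real.exp_add] at h
  rw [Phi_eq_measureReal, ← probReal_compl_eq_one_sub measurableSet_Iic]
  refine (measureReal_mono fun x hx => ?_).trans (h.trans_eq (congrArg _ ?_))
  · exact le_of_lt (not_le.1 (show ¬ x ≤ t from hx))
  · simp
    ring

lemma le_exp_PhiInv {ε x : ℝ} (hε : 0 < ε) (hx : x ∈ Set.Icc ε (1 - ε)) :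
    ε ≤ Real.exp (-PhiInv x ^ 2 / 2) := by
  have hP := Phi_PhiInv (x := x) ⟨hε.trans_le hx.1, by linarith [hx.2]⟩
  rcases le_total (PhiInv x) 0 with h | h
  · linarith [Phi_le_exp h, hx.1]
  · linarith [one_sub_Phi_le_exp h, hx.2]

lemma inv_phi_PhiInv_le {ε x : ℝ} (hε : 0 < ε) (hx : x ∈ Set.Icc ε (1 - ε)) :
    (phi (PhiInv x))⁻¹ ≤ 3 / ε := by
  have h := le_exp_PhiInv hε hx
  have h3 : Real.sqrt (2 * Real.pi) ≤ 3 := by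
    rw [Real.sqrt_le_left (by norm_num)]
    linarith [Real.pi_lt_d2]
  rw [phi, inv_div]
  gcongr

lemma abs_PhiInv_le {ε x : ℝ} (hε : 0 < ε) (hx : x ∈ Set.Icc ε (1 - ε)) :
    |PhiInv x| ≤ 1 / ε := by
  have h := le_exp_PhiInv hε hx
  rw [neg_div, Real.exp_neg, le_inv_comm₀ hε (Real.exp_pos _)] at h
  have := Real.add_one_le_exp (PhiInv x ^ 2 / 2)
  rw [one_div]
  refine le_trans ?_ (this.trans h)
  nlinarith [sq_nonneg (|PhiInv x| - 1), sq_abs (PhiInv x)]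

/-- The density of the centered bivariate Gaussian with unit variances and covariance `ρ`. -/
def dens (ρ s t : ℝ) : ℝ :=
  Real.exp (-(s ^ 2 - 2 * ρ * s * t + t ^ 2) / (2 * (1 - ρ ^ 2))) /
    (2 * Real.pi * Real.sqrt (1 - ρ ^ 2))

/-- The distribution function of the centered bivariate Gaussian with unit variances and
covariance `ρ`. -/
def bivCDF (ρ a b : ℝ) : ℝ := ∫ s in Set.Iic a, ∫ t in Set.Iic b, dens ρ s t

lemma dens_comm (ρ s t : ℝ) : dens ρ s t = dens ρ t s := by
  unfold dens
  ring_nf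

lemma dens_nonneg (ρ s t : ℝ) : 0 ≤ dens ρ s t := by unfold dens; positivity

lemma bivCDF_nonneg (ρ a b : ℝ) : 0 ≤ bivCDF ρ a b :=
  integral_nonneg fun _ => integral_nonneg fun _ => dens_nonneg _ _ _

lemma dens_eq_phi_mul {ρ : ℝ} (hρ0 : 0 < ρ) (hρ1 : ρ < 1) (s t : ℝ) :
    dens ρ s t =
      phi s * phi ((t - ρ * s) / Real.sqrt (1 - ρ ^ 2)) / Real.sqrt (1 - ρ ^ 2) := by
  have hr : 0 < 1 - ρ ^ 2 := by nlinarith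
  have hpi : Real.sqrt (2 * Real.pi) * Real.sqrt (2 * Real.pi) = 2 * Real.pi :=
    Real.mul_self_sqrt (by positivity)
  unfold dens phi
  rw [div_mul_div_comm, hpi, ← Real.exp_add, div_pow, Real.sq_sqrt hr.le, div_div]
  congr 2
  field_simp
  ring

lemma dens_le {ρ : ℝ} (hρ0 : 0 < ρ) (hρ1 : ρ < 1) (s t : ℝ) :
    dens ρ s t ≤ 1 / (2 * Real.pi * Real.sqrt (1 - ρ ^ 2)) *
      (Real.exp (-(1 / (2 * (1 + ρ))) * s ^ 2) * Real.exp (-(1 / (2 * (1 + ρ))) * t ^ 2)) := by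
  have hr : 0 < 1 - ρ ^ 2 := by nlinarith
  unfold dens
  rw [div_mul_eq_mul_div, one_mul, ← Real.exp_add]
  gcongr
  have h : -(1 / (2 * (1 + ρ))) * s ^ 2 + -(1 / (2 * (1 + ρ))) * t ^ 2 =
      -((1 - ρ) * (s ^ 2 + t ^ 2)) / (2 * (1 - ρ ^ 2)) := by
    have : 1 - ρ ≠ 0 := by linarith
    rw [show 1 - ρ ^ 2 = (1 + ρ) * (1 - ρ) by ring]
    field_simp
    ring
  rw [h]
  gcongr
  nlinarith [mul_nonneg hρ0.le (sq_nonneg (s - t))]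

lemma integrable_dens {ρ : ℝ} (hρ0 : 0 < ρ) (hρ1 : ρ < 1) :
    Integrable (Function.uncurry (dens ρ)) := by
  have hc : 0 < 1 / (2 * (1 + ρ)) := by positivity
  have hg := integrable_exp_neg_mul_sq hc
  refine ((hg.mul_prod hg).const_mul (1 / (2 * Real.pi * Real.sqrt (1 - ρ ^ 2)))).mono' ?_ (Filter.Eventually.of_forall fun z => ?_)
  · refine Continuous.aestronglyMeasurable ?_
    unfold Function.uncurry dens
    fun_prop
  · refine (Real.norm_of_nonneg (dens_nonneg _ _ _)).trans_le ?_
    exact dens_le hρ0 hρ1 z.1 z.2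

lemma bivCDF_comm {ρ : ℝ} (hρ0 : 0 < ρ) (hρ1 : ρ < 1) (a b : ℝ) :
    bivCDF ρ a b = bivCDF ρ b a := by
  unfold bivCDF
  rw [integral_integral_swap]
  · simp only [dens_comm ρ]
  · rw [Measure.prod_restrict]
    exact (integrable_dens hρ0 hρ1).integrableOn

lemma integral_Iic_comp_sub_div (f : ℝ → ℝ) (b c : ℝ) {r : ℝ} (hr : 0 < r) :
    ∫ t in Set.Iic b, f ((t - c) / r) = r * ∫ t in Set.Iic ((b - c) / r), f t := by
  rw [← integral_indicator measurableSet_Iic, ← integral_indicator measurableSet_Iic]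
  have h1 := integral_sub_right_eq_self (μ := volume)
    (fun t => (Set.Iic ((b - c) / r)).indicator f (t / r)) c
  have h2 := Measure.integral_comp_div (fun t => (Set.Iic ((b - c) / r)).indicator f t) r
  rw [h2, abs_of_pos hr, smul_eq_mul] at h1
  rw [← h1]
  congr 1 with t
  by_cases ht : t ≤ b
  · rw [Set.indicator_of_mem (show t ∈ Set.Iic b from ht), Set.indicator_of_mem]
    exact div_le_div_of_nonneg_right (by linarith) hr.le
  · rw [Set.indicator_of_notMem (show t ∉ Set.Iic b from ht), Set.indicator_of_notMem]
    rw [Set.mem_Iic, not_le]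
    exact div_lt_div_of_pos_right (by linarith [not_le.1 ht]) hr

lemma integral_dens {ρ : ℝ} (hρ0 : 0 < ρ) (hρ1 : ρ < 1) (s b : ℝ) :
    ∫ t in Set.Iic b, dens ρ s t = phi s * Phi ((b - ρ * s) / Real.sqrt (1 - ρ ^ 2)) := by
  have hr : 0 < Real.sqrt (1 - ρ ^ 2) := Real.sqrt_pos.2 (by nlinarith)
  simp only [dens_eq_phi_mul hρ0 hρ1, mul_div_assoc]
  rw [integral_const_mul, integral_div, integral_Iic_comp_sub_div phi b (ρ * s) hr,
    mul_div_cancel_left₀ _ hr.ne', Phi_eq_integral_phi]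

lemma hasDerivAt_bivCDF_left {ρ : ℝ} (hρ0 : 0 < ρ) (hρ1 : ρ < 1) (a b : ℝ) :
    HasDerivAt (fun x => bivCDF ρ x b) (phi a * Phi ((b - ρ * a) / Real.sqrt (1 - ρ ^ 2))) a := by
  simp only [bivCDF, integral_dens hρ0 hρ1]
  have hc : Continuous fun s => phi s * Phi ((b - ρ * s) / Real.sqrt (1 - ρ ^ 2)) :=
    continuous_phi.mul (continuous_Phi.comp (by fun_prop))
  refine hasDerivAt_integral_Iic ?_ hc a
  refine integrable_phi.mono' hc.aestronglyMeasurable (Filter.Eventually.of_forall fun s => ?_)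
  rw [Phi_eq_measureReal, Real.norm_of_nonneg (mul_nonneg (phi_pos s).le measureReal_nonneg)]
  exact mul_le_of_le_one_right (phi_pos s).le measureReal_le_one

lemma hasDerivAt_bivCDF_comp {ρ : ℝ} (hρ0 : 0 < ρ) (hρ1 : ρ < 1) {s t : ℝ → ℝ} {p q τ : ℝ}
    (hs : HasDerivAt s p τ) (ht : HasDerivAt t q τ) :
    HasDerivAt (fun x => bivCDF ρ (s x) (t x))
      (phi (s τ) * Phi ((t τ - ρ * s τ) / Real.sqrt (1 - ρ ^ 2)) * p +
        phi (t τ) * Phi ((s τ - ρ * t τ) / Real.sqrt (1 - ρ ^ 2)) * q) τ := by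
  have h2 (a b : ℝ) : HasDerivAt (fun y => bivCDF ρ a y)
      (phi b * Phi ((a - ρ * b) / Real.sqrt (1 - ρ ^ 2))) b := by
    simp only [bivCDF_comm hρ0 hρ1 a]
    exact hasDerivAt_bivCDF_left hρ0 hρ1 b a
  have hC : Continuous fun z : ℝ × ℝ =>
      phi z.1 * Phi ((z.2 - ρ * z.1) / Real.sqrt (1 - ρ ^ 2)) :=
    (continuous_phi.comp continuous_fst).mul (continuous_Phi.comp (by fun_prop))
  have hF := hasStrictFDerivAt_uncurry_coprod (𝕜 := ℝ) (u := (s τ, t τ)) (f := bivCDF ρ)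
    (f₁ := fun a b => ContinuousLinearMap.toSpanSingleton ℝ
      (phi a * Phi ((b - ρ * a) / Real.sqrt (1 - ρ ^ 2))))
    (f₂ := fun a b => ContinuousLinearMap.toSpanSingleton ℝ
      (phi b * Phi ((a - ρ * b) / Real.sqrt (1 - ρ ^ 2))))
    (Filter.Eventually.of_forall fun v => (hasDerivAt_bivCDF_left hρ0 hρ1 v.1 v.2).hasFDerivAt)
    (Filter.Eventually.of_forall fun v => (h2 v.1 v.2).hasFDerivAt)
    ((ContinuousLinearMap.toSpanSingletonCLE (𝕜 := ℝ) (E := ℝ)).continuous.comp hC).continuousAt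
    ((ContinuousLinearMap.toSpanSingletonCLE (𝕜 := ℝ) (E := ℝ)).continuous.comp
      (hC.comp continuous_swap)).continuousAt
  have h := hF.hasFDerivAt.comp_hasDerivAt τ (hs.prodMk ht)
  refine h.congr_deriv ?_
  simp [Function.HasUncurry.uncurry, mul_comm]

lemma hasDerivAt_dens_comp (ρ : ℝ) {s t : ℝ → ℝ} {p q τ : ℝ}
    (hs : HasDerivAt s p τ) (ht : HasDerivAt t q τ) :
    HasDerivAt (fun x => dens ρ (s x) (t x))
      (dens ρ (s τ) (t τ) *
        (-(2 * s τ * p - 2 * ρ * (p * t τ + s τ * q) + 2 * t τ * q) / (2 * (1 - ρ ^ 2)))) τ := by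
  have h := (((((hs.mul hs).sub ((hs.mul ht).const_mul (2 * ρ))).add (ht.mul ht)).neg.div_const
    (2 * (1 - ρ ^ 2))).exp).div_const (2 * Real.pi * Real.sqrt (1 - ρ ^ 2))
  have hfun : (fun x => dens ρ (s x) (t x)) = fun x =>
      Real.exp (-(s x * s x - 2 * ρ * (s x * t x) + t x * t x) / (2 * (1 - ρ ^ 2))) /
        (2 * Real.pi * Real.sqrt (1 - ρ ^ 2)) := by
    ext x
    unfold dens
    ring_nf
  rw [hfun, congrFun hfun τ]
  refine h.congr_deriv ?_
  simp only [Pi.neg_apply, Pi.add_apply, Pi.sub_apply, Pi.mul_apply]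
  ring

lemma hasDerivAt_div_phi {s : ℝ → ℝ} {d τ : ℝ} (hs : HasDerivAt s (d / phi (s τ)) τ) :
    HasDerivAt (fun x => d / phi (s x)) (s τ * (d / phi (s τ)) ^ 2) τ := by
  have h := (((hasDerivAt_phi (s τ)).comp τ hs).inv (phi_pos _).ne').const_mul d
  refine h.congr_deriv ?_
  have := (phi_pos (s τ)).ne'
  simp only [Function.comp]
  field_simp

lemma hasDerivAt_const_mul_Phi {ρ : ℝ} (hρ0 : 0 < ρ) (hρ1 : ρ < 1) {s t : ℝ → ℝ} {d q τ : ℝ}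
    (hs : HasDerivAt s (d / phi (s τ)) τ) (ht : HasDerivAt t q τ) :
    HasDerivAt (fun x => d * Phi ((t x - ρ * s x) / Real.sqrt (1 - ρ ^ 2)))
      (dens ρ (s τ) (t τ) * (d / phi (s τ) * (q - ρ * (d / phi (s τ))))) τ := by
  have h := (((hasDerivAt_Phi _).comp τ
    ((ht.sub (hs.const_mul ρ)).div_const (Real.sqrt (1 - ρ ^ 2)))).const_mul d)
  refine h.congr_deriv ?_
  have := (phi_pos (s τ)).ne'
  rw [dens_eq_phi_mul hρ0 hρ1]
  simp only [Pi.sub_apply]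
  field_simp

lemma nonpos_of_hasDerivAt_nonpos {f f' : ℝ → ℝ}
    (hf : ∀ τ ∈ Set.Icc (0 : ℝ) 1, HasDerivAt f (f' τ) τ) (h0 : f 0 = 0)
    (hf' : ∀ τ ∈ Set.Icc (0 : ℝ) 1, f' τ ≤ 0) : ∀ τ ∈ Set.Icc (0 : ℝ) 1, f τ ≤ 0 := by
  intro τ hτ
  have hanti : AntitoneOn f (Set.Icc 0 1) := by
    refine antitoneOn_of_hasDerivWithinAt_nonpos (convex_Icc 0 1)
      (fun x hx => (hf x hx).continuousAt.continuousWithinAt)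
      (fun x hx => (hf x (interior_subset hx)).hasDerivWithinAt)
      (fun x hx => hf' x (interior_subset hx))
  exact h0 ▸ hanti ⟨le_rfl, zero_le_one⟩ hτ hτ.1

lemma le_taylor_of_third_deriv_le {g g₁ g₂ g₃ : ℝ → ℝ} {M : ℝ}
    (h₁ : ∀ τ ∈ Set.Icc (0 : ℝ) 1, HasDerivAt g (g₁ τ) τ)
    (h₂ : ∀ τ ∈ Set.Icc (0 : ℝ) 1, HasDerivAt g₁ (g₂ τ) τ)
    (h₃ : ∀ τ ∈ Set.Icc (0 : ℝ) 1, HasDerivAt g₂ (g₃ τ) τ)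
    (hM : ∀ τ ∈ Set.Icc (0 : ℝ) 1, g₃ τ ≤ M) :
    g 1 ≤ g 0 + g₁ 0 + g₂ 0 / 2 + M / 6 := by
  have k₂ := nonpos_of_hasDerivAt_nonpos (f := fun τ => g₂ τ - (g₂ 0 + τ * M))
    (f' := fun τ => g₃ τ - M)
    (fun τ hτ => by
      refine ((h₃ τ hτ).sub (((hasDerivAt_id τ).mul_const M).const_add (g₂ 0))).congr_deriv ?_
      rw [one_mul])
    (by simp) (fun τ hτ => by linarith [hM τ hτ])
  have k₁ := nonpos_of_hasDerivAt_nonpos (f := fun τ => g₁ τ - (g₁ 0 + τ * g₂ 0 + τ ^ 2 * (M / 2)))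
    (f' := fun τ => g₂ τ - (g₂ 0 + τ * M))
    (fun τ hτ => by
      refine ((h₂ τ hτ).sub ((((hasDerivAt_id τ).mul_const (g₂ 0)).const_add (g₁ 0)).add
        ((hasDerivAt_pow 2 τ).mul_const (M / 2)))).congr_deriv ?_
      norm_num
      ring)
    (by simp) k₂
  have k₀ := nonpos_of_hasDerivAt_nonpos
    (f := fun τ => g τ - (g 0 + τ * g₁ 0 + τ ^ 2 * (g₂ 0 / 2) + τ ^ 3 * (M / 6)))
    (f' := fun τ => g₁ τ - (g₁ 0 + τ * g₂ 0 + τ ^ 2 * (M / 2)))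
    (fun τ hτ => by
      refine ((h₁ τ hτ).sub (((((hasDerivAt_id τ).mul_const (g₁ 0)).const_add (g 0)).add
        ((hasDerivAt_pow 2 τ).mul_const (g₂ 0 / 2))).add
        ((hasDerivAt_pow 3 τ).mul_const (M / 6)))).congr_deriv ?_
      norm_num
      ring)
    (by simp) k₁ 1 ⟨zero_le_one, le_rfl⟩
  linarith

lemma third_deriv_le {ρ : ℝ} (hρ0 : 0 < ρ) (hρ1 : ρ < 1) {s t p q S P : ℝ}
    (hs : |s| ≤ S) (ht : |t| ≤ S) (hp : |p| ≤ P) (hq : |q| ≤ P) :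
    dens ρ s t * (-(2 * s * p - 2 * ρ * (p * t + s * q) + 2 * t * q) / (2 * (1 - ρ ^ 2))) *
        (p * (q - ρ * p) + q * (p - ρ * q)) +
      dens ρ s t * ((s * p ^ 2 * (q - ρ * p) + p * (t * q ^ 2 - ρ * (s * p ^ 2))) +
        (t * q ^ 2 * (p - ρ * q) + q * (s * p ^ 2 - ρ * (t * q ^ 2)))) ≤
      24 / (2 * Real.pi * Real.sqrt (1 - ρ ^ 2) * (1 - ρ ^ 2)) * (S * P ^ 3) := by
  have hS : 0 ≤ S := (abs_nonneg _).trans hs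
  have hP : 0 ≤ P := (abs_nonneg _).trans hp
  have hr : 0 < 1 - ρ ^ 2 := by nlinarith
  have hr1 : 1 - ρ ^ 2 ≤ 1 := by nlinarith
  have hρ : |ρ| ≤ 1 := abs_le.2 ⟨by linarith, hρ1.le⟩
  have hmul {x y a b : ℝ} (hx : |x| ≤ a) (hy : |y| ≤ b) : |x * y| ≤ a * b := by
    rw [abs_mul]
    exact mul_le_mul hx hy (abs_nonneg _) ((abs_nonneg _).trans hx)
  have hadd {x y a b : ℝ} (hx : |x| ≤ a) (hy : |y| ≤ b) : |x + y| ≤ a + b :=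
    (abs_add_le x y).trans (add_le_add hx hy)
  have hsub {x y a b : ℝ} (hx : |x| ≤ a) (hy : |y| ≤ b) : |x - y| ≤ a + b :=
    (abs_sub x y).trans (add_le_add hx hy)
  have hpp : |p ^ 2| ≤ P * P := by rw [pow_two]; exact hmul hp hp
  have hqq : |q ^ 2| ≤ P * P := by rw [pow_two]; exact hmul hq hq
  have hA := hadd (hsub (hmul hs hp) (hmul hρ (hadd (hmul hp ht) (hmul hs hq)))) (hmul ht hq)
  have hB := hadd (hmul hp (hsub hq (hmul hρ hp))) (hmul hq (hsub hp (hmul hρ hq)))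
  have hC := hadd
    (hadd (hmul (hmul hs hpp) (hsub hq (hmul hρ hp)))
      (hmul hp (hsub (hmul ht hqq) (hmul hρ (hmul hs hpp)))))
    (hadd (hmul (hmul ht hqq) (hsub hp (hmul hρ hq)))
      (hmul hq (hsub (hmul hs hpp) (hmul hρ (hmul ht hqq)))))
  have hAB := hmul hA hB
  have hSP : 0 ≤ S * P ^ 3 := by positivity
  have hdens : dens ρ s t ≤ 1 / (2 * Real.pi * Real.sqrt (1 - ρ ^ 2)) := by
    refine (dens_le hρ0 hρ1 s t).trans (mul_le_of_le_one_right (by positivity) ?_)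
    rw [← Real.exp_add, Real.exp_le_one_iff]
    have : 0 < 1 / (2 * (1 + ρ)) := by positivity
    nlinarith [mul_nonneg this.le (sq_nonneg s), mul_nonneg this.le (sq_nonneg t)]
  set A := s * p - ρ * (p * t + s * q) + t * q
  set B := p * (q - ρ * p) + q * (p - ρ * q)
  set D := (s * p ^ 2 * (q - ρ * p) + p * (t * q ^ 2 - ρ * (s * p ^ 2))) +
        (t * q ^ 2 * (p - ρ * q) + q * (s * p ^ 2 - ρ * (t * q ^ 2)))
  have hAB' : -(A * B) ≤ 16 * (S * P ^ 3) := by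
    refine (neg_le_abs _).trans (hAB.trans_eq ?_)
    ring
  have hD' : D ≤ 8 * (S * P ^ 3) / (1 - ρ ^ 2) := by
    refine ((le_abs_self _).trans hC).trans ?_
    rw [le_div_iff₀ hr]
    nlinarith
  have hsum : -(A * B) / (1 - ρ ^ 2) + D ≤ 24 * (S * P ^ 3) / (1 - ρ ^ 2) := by
    have := div_le_div_of_nonneg_right hAB' hr.le
    calc _ ≤ 16 * (S * P ^ 3) / (1 - ρ ^ 2) + 8 * (S * P ^ 3) / (1 - ρ ^ 2) := add_le_add this hD'
      _ = _ := by ring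
  calc _ = dens ρ s t * (-(A * B) / (1 - ρ ^ 2) + D) := by
        simp only [A]
        field_simp
    _ ≤ dens ρ s t * (24 * (S * P ^ 3) / (1 - ρ ^ 2)) :=
        mul_le_mul_of_nonneg_left hsum (dens_nonneg _ _ _)
    _ ≤ 1 / (2 * Real.pi * Real.sqrt (1 - ρ ^ 2)) * (24 * (S * P ^ 3) / (1 - ρ ^ 2)) :=
        mul_le_mul_of_nonneg_right hdens (by positivity)
    _ = _ := by
        field_simp

lemma bivCDF_PhiInv_le_taylor {ρ : ℝ} (hρ0 : 0 < ρ) (hρ1 : ρ < 1) {ε x y m n : ℝ} (hε : 0 < ε)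
    (hx : x ∈ Set.Icc ε (1 - ε)) (hy : y ∈ Set.Icc ε (1 - ε))
    (hm : m ∈ Set.Icc ε (1 - ε)) (hn : n ∈ Set.Icc ε (1 - ε)) :
    bivCDF ρ (PhiInv x) (PhiInv y) ≤ bivCDF ρ (PhiInv m) (PhiInv n) +
      ((x - m) * Phi ((PhiInv n - ρ * PhiInv m) / Real.sqrt (1 - ρ ^ 2)) +
        (y - n) * Phi ((PhiInv m - ρ * PhiInv n) / Real.sqrt (1 - ρ ^ 2))) +
      dens ρ (PhiInv m) (PhiInv n) *
        ((x - m) / phi (PhiInv m) * ((y - n) / phi (PhiInv n) - ρ * ((x - m) / phi (PhiInv m))) +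
          (y - n) / phi (PhiInv n) *
            ((x - m) / phi (PhiInv m) - ρ * ((y - n) / phi (PhiInv n)))) / 2 +
      432 / (2 * Real.pi * Real.sqrt (1 - ρ ^ 2) * (1 - ρ ^ 2)) * (1 / ε) ^ 4 *
        (|x - m| ^ 3 + |y - n| ^ 3) := by
  have hmem {u v τ : ℝ} (hu : u ∈ Set.Icc ε (1 - ε)) (hv : v ∈ Set.Icc ε (1 - ε))
      (hτ : τ ∈ Set.Icc (0 : ℝ) 1) : v + τ * (u - v) ∈ Set.Icc ε (1 - ε) :=
    (convex_Icc ε (1 - ε)).add_smul_sub_mem hv hu hτ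
  have hder {u v τ : ℝ} (hu : u ∈ Set.Icc ε (1 - ε)) (hv : v ∈ Set.Icc ε (1 - ε))
      (hτ : τ ∈ Set.Icc (0 : ℝ) 1) : HasDerivAt (fun τ => PhiInv (v + τ * (u - v)))
        ((u - v) / phi (PhiInv (v + τ * (u - v)))) τ := by
    have hz := hmem hu hv hτ
    refine ((hasDerivAt_PhiInv ⟨hε.trans_le hz.1, by linarith [hz.2]⟩).comp τ
      (((hasDerivAt_id τ).mul_const (u - v)).const_add v)).congr_deriv ?_
    simp [div_eq_inv_mul]
  set s : ℝ → ℝ := fun τ => PhiInv (m + τ * (x - m)) with hs_def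
  set t : ℝ → ℝ := fun τ => PhiInv (n + τ * (y - n)) with ht_def
  have hs (τ) (hτ : τ ∈ Set.Icc (0 : ℝ) 1) : HasDerivAt s ((x - m) / phi (s τ)) τ := hder hx hm hτ
  have ht (τ) (hτ : τ ∈ Set.Icc (0 : ℝ) 1) : HasDerivAt t ((y - n) / phi (t τ)) τ := hder hy hn hτ
  have hbound (u v d τ : ℝ) (hu : u ∈ Set.Icc ε (1 - ε)) (hv : v ∈ Set.Icc ε (1 - ε))
      (hd : |d| ≤ |x - m| + |y - n|) (hτ : τ ∈ Set.Icc (0 : ℝ) 1) :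
      |d / phi (PhiInv (v + τ * (u - v)))| ≤ 3 / ε * (|x - m| + |y - n|) := by
    rw [abs_div, abs_of_pos (phi_pos _), div_eq_inv_mul]
    exact mul_le_mul (inv_phi_PhiInv_le hε (hmem hu hv hτ)) hd (abs_nonneg _) (by positivity)
  have key := le_taylor_of_third_deriv_le
    (g := fun τ => bivCDF ρ (s τ) (t τ))
    (g₁ := fun τ => (x - m) * Phi ((t τ - ρ * s τ) / Real.sqrt (1 - ρ ^ 2)) +
      (y - n) * Phi ((s τ - ρ * t τ) / Real.sqrt (1 - ρ ^ 2)))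
    (g₂ := fun τ => dens ρ (s τ) (t τ) *
      ((x - m) / phi (s τ) * ((y - n) / phi (t τ) - ρ * ((x - m) / phi (s τ))) +
        (y - n) / phi (t τ) * ((x - m) / phi (s τ) - ρ * ((y - n) / phi (t τ)))))
    (fun τ hτ => by
      refine (hasDerivAt_bivCDF_comp hρ0 hρ1 (hs τ hτ) (ht τ hτ)).congr_deriv ?_
      have h1 := (phi_pos (s τ)).ne'
      have h2 := (phi_pos (t τ)).ne'
      field_simp)
    (fun τ hτ => by
      refine ((hasDerivAt_const_mul_Phi hρ0 hρ1 (hs τ hτ) (ht τ hτ)).add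
        (hasDerivAt_const_mul_Phi hρ0 hρ1 (ht τ hτ) (hs τ hτ))).congr_deriv ?_
      rw [dens_comm ρ (t τ) (s τ), mul_add])
    (fun τ hτ => by
      have hp := hasDerivAt_div_phi (hs τ hτ)
      have hq := hasDerivAt_div_phi (ht τ hτ)
      exact (hasDerivAt_dens_comp ρ (hs τ hτ) (ht τ hτ)).mul
        ((hp.mul (hq.sub (hp.const_mul ρ))).add (hq.mul (hp.sub (hq.const_mul ρ)))))
    (fun τ hτ => third_deriv_le hρ0 hρ1 (abs_PhiInv_le hε (hmem hx hm hτ))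
      (abs_PhiInv_le hε (hmem hy hn hτ))
      (hbound x m (x - m) τ hx hm (by linarith [abs_nonneg (y - n)]) hτ)
      (hbound y n (y - n) τ hy hn (by linarith [abs_nonneg (x - m)]) hτ))
  simp only [hs_def, ht_def, zero_mul, add_zero, one_mul, add_sub_cancel] at key
  refine key.trans (add_le_add_right ?_ _)
  have hr : 0 < 1 - ρ ^ 2 := by nlinarith
  have hcube : (|x - m| + |y - n|) ^ 3 ≤ 4 * (|x - m| ^ 3 + |y - n| ^ 3) := by
    have h1 := abs_nonneg (x - m)
    have h2 := abs_nonneg (y - n)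
    nlinarith [mul_nonneg (add_nonneg h1 h2) (sq_nonneg (|x - m| - |y - n|))]
  calc _ = 108 / (2 * Real.pi * Real.sqrt (1 - ρ ^ 2) * (1 - ρ ^ 2)) * (1 / ε) ^ 4 *
        (|x - m| + |y - n|) ^ 3 := by ring
    _ ≤ 108 / (2 * Real.pi * Real.sqrt (1 - ρ ^ 2) * (1 - ρ ^ 2)) * (1 / ε) ^ 4 *
        (4 * (|x - m| ^ 3 + |y - n| ^ 3)) := by gcongr
    _ = _ := by ring

lemma J_eq_bivCDF {ρ x y : ℝ} (hx : x ∈ Set.Ioo (0 : ℝ) 1) (hy : y ∈ Set.Ioo (0 : ℝ) 1) :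
    J ρ x y = bivCDF ρ (PhiInv x) (PhiInv y) := by
  rw [J, if_neg (not_or.2 ⟨hx.1.ne', hy.1.ne'⟩), if_neg hx.2.ne, if_neg hy.2.ne]
  rfl

lemma integral_quadratic_cubic {Ω : Type*} [MeasurableSpace Ω] {μ : Measure Ω}
    [IsProbabilityMeasure μ] {U V : Ω → ℝ} (hU : Measurable U) (hV : Measurable V) {b : ℝ}
    (hUb : ∀ ω, |U ω| ≤ b) (hVb : ∀ ω, |V ω| ≤ b) (c₀ c₁ c₂ c₁₁ c₁₂ c₂₂ k : ℝ) :
    Integrable (fun ω => c₀ + (c₁ * U ω + c₂ * V ω) +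
        (c₁₁ * U ω ^ 2 + c₁₂ * (U ω * V ω) + c₂₂ * V ω ^ 2) + k * (|U ω| ^ 3 + |V ω| ^ 3)) μ ∧
      ∫ ω, c₀ + (c₁ * U ω + c₂ * V ω) + (c₁₁ * U ω ^ 2 + c₁₂ * (U ω * V ω) + c₂₂ * V ω ^ 2) +
          k * (|U ω| ^ 3 + |V ω| ^ 3) ∂μ =
        c₀ + (c₁ * ∫ ω, U ω ∂μ + c₂ * ∫ ω, V ω ∂μ) +
          (c₁₁ * ∫ ω, U ω ^ 2 ∂μ + c₁₂ * ∫ ω, U ω * V ω ∂μ + c₂₂ * ∫ ω, V ω ^ 2 ∂μ) +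
          k * (∫ ω, |U ω| ^ 3 ∂μ + ∫ ω, |V ω| ^ 3 ∂μ) := by
  have hpow {W : Ω → ℝ} (hW : Measurable W) (hWb : ∀ ω, |W ω| ≤ b) (j : ℕ) :
      Integrable (fun ω => |W ω| ^ j) μ := by
    refine Integrable.of_bound (by fun_prop) (b ^ j) (Filter.Eventually.of_forall fun ω => ?_)
    rw [norm_pow, Real.norm_eq_abs, abs_abs]
    exact pow_le_pow_left₀ (abs_nonneg _) (hWb ω) j
  have iU : Integrable U μ := Integrable.of_bound hU.aestronglyMeasurable b
    (Filter.Eventually.of_forall hUb)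
  have iV : Integrable V μ := Integrable.of_bound hV.aestronglyMeasurable b
    (Filter.Eventually.of_forall hVb)
  have iUV : Integrable (fun ω => U ω * V ω) μ :=
    iV.bdd_mul hU.aestronglyMeasurable (Filter.Eventually.of_forall hUb)
  have iU2 : Integrable (fun ω => U ω ^ 2) μ := by simpa only [sq_abs] using hpow hU hUb 2
  have iV2 : Integrable (fun ω => V ω ^ 2) μ := by simpa only [sq_abs] using hpow hV hVb 2
  have i1 := (iU.const_mul c₁).add (iV.const_mul c₂)
  have i2 := ((iU2.const_mul c₁₁).add (iUV.const_mul c₁₂)).add (iV2.const_mul c₂₂)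
  have i3 := ((hpow hU hUb 3).add (hpow hV hVb 3)).const_mul k
  refine ⟨(((integrable_const c₀).add i1).add i2).add i3, ?_⟩
  refine (integral_add (((integrable_const c₀).add i1).add i2) i3).trans (congrArg₂ _ ?_ ?_)
  · refine (integral_add ((integrable_const c₀).add i1) i2).trans (congrArg₂ _ ?_ ?_)
    · refine (integral_add (integrable_const c₀) i1).trans (congrArg₂ _ (by simp) ?_)
      refine (integral_add (iU.const_mul c₁) (iV.const_mul c₂)).trans ?_
      rw [integral_const_mul, integral_const_mul]
    · refine (integral_add ((iU2.const_mul c₁₁).add (iUV.const_mul c₁₂))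
        (iV2.const_mul c₂₂)).trans (congrArg₂ _ ?_ (integral_const_mul _ _))
      refine (integral_add (iU2.const_mul c₁₁) (iUV.const_mul c₁₂)).trans ?_
      rw [integral_const_mul, integral_const_mul]
  · refine (integral_const_mul _ _).trans ?_
    rw [← integral_add (hpow hU hUb 3) (hpow hV hVb 3)]
    rfl

lemma quadratic_form_nonpos {ρ σ v w α β : ℝ} (hσ : σ ≤ ρ) (hv : 0 ≤ v) (hw : 0 ≤ w) (hα : 0 ≤ α)
    (hβ : 0 ≤ β) (hρ : 0 ≤ ρ) :
    -(ρ * α ^ 2) * v + 2 * α * β * (σ * Real.sqrt (v * w)) + -(ρ * β ^ 2) * w ≤ 0 := by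
  rw [Real.sqrt_mul hv]
  have h1 : 0 ≤ α * Real.sqrt v * (β * Real.sqrt w) := by positivity
  have h2 := mul_nonneg hρ (sq_nonneg (α * Real.sqrt v - β * Real.sqrt w))
  have h3 := mul_le_mul_of_nonneg_right hσ h1
  have h4 : -(ρ * α ^ 2) * v + 2 * α * β * (σ * (Real.sqrt v * Real.sqrt w)) +
      -(ρ * β ^ 2) * w = 2 * (σ * (α * Real.sqrt v * (β * Real.sqrt w)) -
        ρ * (α * Real.sqrt v * (β * Real.sqrt w))) -
        ρ * (α * Real.sqrt v - β * Real.sqrt w) ^ 2 := by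
    linear_combination ρ * α ^ 2 * Real.sq_sqrt hv + ρ * β ^ 2 * Real.sq_sqrt hw
  linarith

/-- **Base case** (Claim 3.3): one-dimensional Taylor-expansion inequality for `J_ρ`. -/
theorem base_case (ρ : ℝ) (hρ0 : 0 < ρ) (hρ1 : ρ < 1) :
    ∃ C : ℝ, 0 < C ∧ ∀ ε : ℝ, 0 < ε →
      ∀ (Ω : Type) [MeasurableSpace Ω] (μ : Measure Ω) [IsProbabilityMeasure μ]
        (X Y : Ω → ℝ), Measurable X → Measurable Y →
        (∀ ω, X ω ∈ Set.Icc ε (1 - ε)) → (∀ ω, Y ω ∈ Set.Icc ε (1 - ε)) →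
        (∃ σ : ℝ, 0 ≤ σ ∧ σ ≤ ρ ∧
          (∫ ω, (X ω - ∫ ω', X ω' ∂μ) * (Y ω - ∫ ω', Y ω' ∂μ) ∂μ) =
            σ * Real.sqrt ((∫ ω, (X ω - ∫ ω', X ω' ∂μ) ^ 2 ∂μ) *
              (∫ ω, (Y ω - ∫ ω', Y ω' ∂μ) ^ 2 ∂μ))) →
        (∫ ω, J ρ (X ω) (Y ω) ∂μ) ≤
          J ρ (∫ ω, X ω ∂μ) (∫ ω, Y ω ∂μ) +
            C * ε ^ (-C) *
              ((∫ ω, |X ω - ∫ ω', X ω' ∂μ| ^ 3 ∂μ) +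
                (∫ ω, |Y ω - ∫ ω', Y ω' ∂μ| ^ 3 ∂μ)) := by
  have hr : 0 < 1 - ρ ^ 2 := by nlinarith
  set K : ℝ := 432 / (2 * Real.pi * Real.sqrt (1 - ρ ^ 2) * (1 - ρ ^ 2))
  have hK : 0 < K := by positivity
  refine ⟨max K 4, by positivity, fun ε hε Ω _ μ _ X Y hXm hYm hX hY ⟨σ, hσ0, hσ, hcov⟩ => ?_⟩
  have hmean {Z : Ω → ℝ} (hZm : Measurable Z) (hZ : ∀ ω, Z ω ∈ Set.Icc ε (1 - ε)) :
      Integrable Z μ ∧ ∫ ω, Z ω ∂μ ∈ Set.Icc ε (1 - ε) := by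
    have hi : Integrable Z μ := Integrable.of_mem_Icc ε (1 - ε) hZm.aemeasurable
      (Filter.Eventually.of_forall hZ)
    exact ⟨hi, (convex_Icc ε (1 - ε)).integral_mem isClosed_Icc (Filter.Eventually.of_forall hZ) hi⟩
  obtain ⟨hXi, hm⟩ := hmean hXm hX
  obtain ⟨hYi, hn⟩ := hmean hYm hY
  set m := ∫ ω, X ω ∂μ
  set n := ∫ ω, Y ω ∂μ
  have hIoo {z : ℝ} (hz : z ∈ Set.Icc ε (1 - ε)) : z ∈ Set.Ioo (0 : ℝ) 1 :=
    ⟨hε.trans_le hz.1, by linarith [hz.2]⟩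
  have hdist {u v : ℝ} (hu : u ∈ Set.Icc ε (1 - ε)) (hv : v ∈ Set.Icc ε (1 - ε)) : |u - v| ≤ 1 :=
    abs_le.2 ⟨by linarith [hu.1, hv.2], by linarith [hu.2, hv.1]⟩
  set a := PhiInv m
  set b := PhiInv n
  obtain ⟨hint, heq⟩ := integral_quadratic_cubic (μ := μ) (U := fun ω => X ω - m)
    (V := fun ω => Y ω - n) (hXm.sub_const m) (hYm.sub_const n)
    (fun ω => hdist (hX ω) hm) (fun ω => hdist (hY ω) hn) (bivCDF ρ a b)
    (Phi ((b - ρ * a) / Real.sqrt (1 - ρ ^ 2))) (Phi ((a - ρ * b) / Real.sqrt (1 - ρ ^ 2)))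
    (dens ρ a b / 2 * -(ρ * (phi a)⁻¹ ^ 2)) (dens ρ a b / 2 * (2 * (phi a)⁻¹ * (phi b)⁻¹))
    (dens ρ a b / 2 * -(ρ * (phi b)⁻¹ ^ 2)) (K * (1 / ε) ^ 4)
  have hle := integral_mono_of_nonneg (μ := μ) (f := fun ω => J ρ (X ω) (Y ω))
    (Filter.Eventually.of_forall fun ω => by
      simp only [J_eq_bivCDF (hIoo (hX ω)) (hIoo (hY ω)), Pi.zero_apply, bivCDF_nonneg]) hint
    (Filter.Eventually.of_forall fun ω => by
      simp only [J_eq_bivCDF (hIoo (hX ω)) (hIoo (hY ω))]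
      refine (bivCDF_PhiInv_le_taylor hρ0 hρ1 hε (hX ω) (hY ω) hm hn).trans_eq ?_
      simp only [div_eq_mul_inv]
      ring)
  rw [heq, hcov, integral_sub hXi (integrable_const m), integral_sub hYi (integrable_const n)] at hle
  have hquad := mul_nonpos_of_nonneg_of_nonpos (div_nonneg (dens_nonneg ρ a b) zero_le_two)
    (quadratic_form_nonpos hσ
    (integral_nonneg fun ω => sq_nonneg (X ω - m) : 0 ≤ ∫ ω, (X ω - m) ^ 2 ∂μ)
    (integral_nonneg fun ω => sq_nonneg (Y ω - n) : 0 ≤ ∫ ω, (Y ω - n) ^ 2 ∂μ)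
    (inv_pos.2 (phi_pos a)).le (inv_pos.2 (phi_pos b)).le hρ0.le)
  have hT : 0 ≤ ∫ ω, |X ω - m| ^ 3 ∂μ + ∫ ω, |Y ω - n| ^ 3 ∂μ :=
    add_nonneg (integral_nonneg fun ω => by positivity) (integral_nonneg fun ω => by positivity)
  have hconst : K * (1 / ε) ^ 4 ≤ max K 4 * ε ^ (-max K 4) := by
    refine mul_le_mul (le_max_left K 4) ?_ (by positivity) (by positivity)
    rw [one_div, inv_pow, ← Real.rpow_natCast, ← Real.rpow_neg hε.le]
    refine Real.rpow_le_rpow_of_exponent_ge hε (by linarith [hm.1, hm.2]) ?_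
    norm_num
  have hrem := mul_le_mul_of_nonneg_right hconst hT
  rw [J_eq_bivCDF (hIoo hm) (hIoo hn)]
  simp only [integral_const, probReal_univ, one_smul] at hle
  rw [sub_self, sub_self] at hle
  linarith

end DMN
end
end
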